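/- arXiv:2410.14662 — 2 statements merged into one kernel-verified Lean document; each statement's English description precedes it below -/
import Mathlib

section
/- Let q be a prime power and n, t, k ≥ 1, Δ integers with Δ a multiple of n and n ≤ Δ ≤ q/n. Let Γ = (V = V₀ ⊔ V₁, E ⊆ F_q, v₀, v₁) be the Δ-regular complete balanced bipartite multigraph with |V₀| = |V₁| = n, and let D be a β-biased probability distribution over (F_q^t)^V with β = 1/|V|^{2k+1}, where |V| = 2n. Then for every η ∈ (0,1), the probability over L_V ∼ D that the lifted graph Γ̄ built from Γ and L_V satisfies λ₂(Γ̄) ≥ ηΔ is strictly less than q^t · (4k/(η·|V|^{1/4}))^{2k}. -/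
open scoped BigOperators


/-- The adjacency matrix of the multigraph `(V, E, v0, v1)`: the `(u, w)` entry is the number
of edges joining `u` and `w`. -/
noncomputable def adjMat {V E : Type} (v0 v1 : E → V) : Matrix V V ℝ := fun u w =>
  (Nat.card {e : E // (v0 e = u ∧ v1 e = w) ∨ (v1 e = u ∧ v0 e = w)} : ℝ)

lemma adjMat_symm {V E : Type} (v0 v1 : E → V) (u w : V) :
    adjMat v0 v1 u w = adjMat v0 v1 w u := by
  unfold adjMat
  norm_cast
  exact Nat.card_congr (Equiv.subtypeEquivRight fun e => by tauto)

/-- The second largest eigenvalue (with multiplicity) of a real symmetric matrix. -/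
noncomputable def secondEig {W : Type} [Finite W] (A : Matrix W W ℝ)
    (hsymm : ∀ u w, A u w = A w u) : ℝ :=
  letI : Fintype W := Fintype.ofFinite W
  letI : DecidableEq W := Classical.decEq W
  have hA : A.IsHermitian := by
    refine Matrix.ext fun u w => ?_
    simpa [Matrix.conjTranspose_apply] using hsymm w u
  let l := (Finset.univ.val.map hA.eigenvalues).sort (· ≤ ·)
  l.getD (l.length - 2) 0

/-- The second largest eigenvalue of (the adjacency matrix of) a multigraph. -/
noncomputable def graphLambda2 {V E : Type} [Finite V] (v0 v1 : E → V) : ℝ :=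
  secondEig (adjMat v0 v1) (adjMat_symm v0 v1)

instance quotFinite {F M : Type} [Field F] [AddCommGroup M] [Module F M] [Finite M]
    (p : Submodule F M) : Finite (M ⧸ p) :=
  Finite.of_surjective (Submodule.Quotient.mk : M → M ⧸ p) (Submodule.Quotient.mk_surjective p)

/-- The vertex set of the lifted graph `Γ̄`: the disjoint union over `v ∈ V` of the affine
lines in `F^{t+1} = F × F^t` in direction `(1, L v)` (cosets of the span of `(1, L v)`). -/
def LiftedVertex (F : Type) [Field F] (t : ℕ) {V : Type} (L : V → Fin t → F) : Type :=
  Σ v : V, ((F × (Fin t → F)) ⧸ Submodule.span F {((1 : F), L v)})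

instance {F : Type} [Field F] [Finite F] (t : ℕ) {V : Type} [Finite V] (L : V → Fin t → F) :
    Finite (LiftedVertex F t L) := by
  unfold LiftedVertex; infer_instance

/-- One endpoint of the lifted edge `(e, x) ∈ Ē = E × F^t`: the affine line through the
point `(e, x)` in direction `(1, L (vb e))`, where `vb` sends each edge to one of its
endpoints in the base graph. -/
def liftedEnd (F : Type) [Field F] (t : ℕ) {V : Type} (E : Finset F) (vb : ↥E → V)
    (L : V → Fin t → F) (p : ↥E × (Fin t → F)) : LiftedVertex F t L :=
  ⟨vb p.1, Submodule.Quotient.mk ((p.1 : F), p.2)⟩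

/-- The second largest adjacency eigenvalue of the lifted graph `Γ̄` determined by the base
graph `(V, E ⊆ F, v0, v1)` and the vertex labeling `L : V → F^t`. -/
noncomputable def lambda2Lifted (F : Type) [Field F] [Finite F] (t : ℕ) {V : Type} [Finite V]
    (E : Finset F) (v0 v1 : ↥E → V) (L : V → Fin t → F) : ℝ :=
  graphLambda2 (liftedEnd F t E v0 L) (liftedEnd F t E v1 L)

lemma matB {U W : Type} [Fintype U] [Fintype W] (M : U → W → ℂ) (x : U → ℂ) (y : W → ℂ)
    (μ : ℝ) (hμ : 0 < μ) (hpos : 0 < ∑ u, ‖x u‖ ^ 2 + ∑ w, ‖y w‖ ^ 2)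
    (h : μ * (∑ u, ‖x u‖ ^ 2 + ∑ w, ‖y w‖ ^ 2) ≤
      2 * (∑ u, ∑ w, (starRingEnd ℂ) (x u) * M u w * y w).re) :
    μ ^ 4 ≤ ∑ w, ∑ w', ‖∑ u, (starRingEnd ℂ) (M u w) * M u w'‖ ^ 2 := by
  set X := ∑ u, ‖x u‖ ^ 2 with hX
  set Y := ∑ w, ‖y w‖ ^ 2 with hY
  set T := ∑ w, ∑ w', ‖∑ u, (starRingEnd ℂ) (M u w) * M u w'‖ ^ 2 with hT
  have hX0 : 0 ≤ X := by positivity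
  have hY0 : 0 ≤ Y := by positivity
  set Z := ∑ u, ∑ w, (starRingEnd ℂ) (x u) * M u w * y w with hZ
  set q : U → ℂ := fun u => ∑ w, M u w * y w with hq
  set Q := ∑ u, ‖q u‖ ^ 2 with hQ
  have hQ0 : 0 ≤ Q := by positivity
  -- first Cauchy
  have h1 : ‖Z‖ ^ 2 ≤ X * Q := by
    have e : Z = ∑ u, (starRingEnd ℂ) (x u) * q u := by
      simp only [hZ, hq, Finset.mul_sum, mul_assoc]
    have : ‖Z‖ ≤ ∑ u, ‖x u‖ * ‖q u‖ := by
      rw [e]; refine (norm_sum_le _ _).trans (le_of_eq ?_)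
      simp
    calc ‖Z‖ ^ 2 ≤ (∑ u, ‖x u‖ * ‖q u‖) ^ 2 := by gcongr
      _ ≤ _ := Finset.sum_mul_sq_le_sq_mul_sq _ _ _
  have h2 : Q ^ 2 ≤ Y ^ 2 * T := by
    have e : (Q : ℂ) = ∑ p : W × W, (starRingEnd ℂ) (y p.1) * y p.2 *
        (∑ u, (starRingEnd ℂ) (M u p.1) * M u p.2) := by
      rw [Fintype.sum_prod_type]
      have : ∀ u, ((‖q u‖ ^ 2 : ℝ) : ℂ) = ∑ w, ∑ w', (starRingEnd ℂ) (y w) * y w' *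
          ((starRingEnd ℂ) (M u w) * M u w') := by
        intro u
        push_cast
        rw [← Complex.conj_mul']
        simp only [hq, map_sum, map_mul, Finset.sum_mul_sum]
        refine Finset.sum_congr rfl fun w _ => Finset.sum_congr rfl fun w' _ => by ring
      rw [hQ]
      push_cast
      push_cast at this
      simp only [this, Finset.mul_sum]
      rw [Finset.sum_comm]
      refine Finset.sum_congr rfl fun w _ => ?_
      rw [Finset.sum_comm]
    have : Q ≤ ∑ p : W × W, (‖y p.1‖ * ‖y p.2‖) *
        ‖∑ u, (starRingEnd ℂ) (M u p.1) * M u p.2‖ := by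
      have : Q = ‖(Q : ℂ)‖ := by simp [abs_of_nonneg hQ0]
      rw [this, e]
      refine (norm_sum_le _ _).trans (le_of_eq ?_)
      simp
    calc Q ^ 2 ≤ _ := by gcongr
      _ ≤ _ := Finset.sum_mul_sq_le_sq_mul_sq _ _ _
      _ = Y ^ 2 * T := by
        have e1 : ∑ p : W × W, (‖y p.1‖ * ‖y p.2‖) ^ 2 = Y ^ 2 := by
          rw [Fintype.sum_prod_type, hY, sq (∑ w, ‖y w‖ ^ 2), Finset.sum_mul_sum]
          simp only [mul_pow]
        rw [e1, hT, Fintype.sum_prod_type]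
  have h3 : Z.re ≤ ‖Z‖ := Complex.re_le_norm Z
  have h4 : μ * (X + Y) ≤ 2 * ‖Z‖ := by linarith
  have h5 : μ ^ 2 * (X + Y) ^ 2 ≤ 4 * (X * Q) := by
    have : (μ * (X + Y)) ^ 2 ≤ (2 * ‖Z‖) ^ 2 := by gcongr
    nlinarith
  have h6 : μ ^ 2 * (X * Y) ≤ X * Q := by
    have : 4 * (X * Y) ≤ (X + Y) ^ 2 := by nlinarith [sq_nonneg (X - Y)]
    nlinarith [sq_nonneg μ, mul_le_mul_of_nonneg_left this (sq_nonneg μ)]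
  have hXpos : 0 < X := by
    rcases hX0.lt_or_eq with h | h
    · exact h
    · rw [← h] at h5 hpos
      have : 0 < μ ^ 2 * (0 + Y) ^ 2 := by positivity
      linarith
  have h7 : μ ^ 2 * Y ≤ Q := by
    have : X * (μ ^ 2 * Y) ≤ X * Q := by linarith
    exact le_of_mul_le_mul_left this hXpos
  have hYpos : 0 < Y := by
    rcases hY0.lt_or_eq with h | h
    · exact h
    · rw [← h] at h2
      have : Q = 0 := by nlinarith
      rw [this] at h5
      have : 0 < μ ^ 2 * (X + Y) ^ 2 := by positivity
      linarith
  have h8 : Y ^ 2 * μ ^ 4 ≤ Y ^ 2 * T := by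
    have : (μ ^ 2 * Y) ^ 2 ≤ Q ^ 2 := by gcongr
    nlinarith
  exact le_of_mul_le_mul_left h8 (by positivity)

lemma specC0 {W : Type} [Finite W] (inst : Fintype W) (hinst : inst = Fintype.ofFinite W)
    (A : Matrix W W ℝ)
    (hsymm : ∀ u w, A u w = A w u) (hW : 2 ≤ Fintype.card W) (μ : ℝ)
    (h : μ ≤ secondEig A hsymm) :
    ∃ f : W → ℝ, f ≠ 0 ∧ ∑ w, f w = 0 ∧
      μ * ∑ w, f w ^ 2 ≤ ∑ u, ∑ w, f u * A u w * f w := by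
  let : DecidableEq W := Classical.decEq W
  have hA : A.IsHermitian := by
    refine Matrix.ext fun u w => ?_
    simpa [Matrix.conjTranspose_apply] using hsymm w u
  have h' : μ ≤ ((Finset.univ.val.map hA.eigenvalues).sort (· ≤ ·)).getD
      (((Finset.univ.val.map hA.eigenvalues).sort (· ≤ ·)).length - 2) 0 := by
    subst hinst
    exact h
  set l := (Finset.univ.val.map hA.eigenvalues).sort (· ≤ ·) with hl
  have hlen : l.length = Fintype.card W := by simp [hl]
  have hN : l.length - 2 < l.length := by omega
  have hsort : l.Pairwise (· ≤ ·) := Multiset.pairwise_sort _ _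
  have hcnt : 2 ≤ l.countP (fun x => μ ≤ x) := by
    have h1 : (l.drop (l.length - 2)).countP (fun x => μ ≤ x) = (l.drop (l.length - 2)).length := by
      rw [List.countP_eq_length]
      intro x hx
      have hs2 : (l.drop (l.length - 2)).Pairwise (· ≤ ·) :=
        hsort.sublist (List.drop_sublist _ _)
      rw [List.drop_eq_getElem_cons hN] at hs2 hx
      rw [List.getD_eq_getElem _ _ hN] at h'
      rcases List.mem_cons.1 hx with rfl | hx
      · simpa using h'
      · simpa using h'.trans ((List.pairwise_cons.1 hs2).1 x hx)
    have h2 := (List.drop_sublist (l.length - 2) l).countP_le (p := fun x => μ ≤ x)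
    rw [h1, List.length_drop] at h2
    omega
  have hcard : 2 ≤ (Finset.univ.filter (fun i => μ ≤ hA.eigenvalues i)).card := by
    have : (Finset.univ.filter (fun i => μ ≤ hA.eigenvalues i)).card
        = l.countP (fun x => μ ≤ x) := by
      have e : (l : Multiset ℝ) = Finset.univ.val.map hA.eigenvalues := Multiset.sort_eq _ _
      rw [← Multiset.coe_countP, e, Multiset.countP_map]
      rfl
    omega
  obtain ⟨i, hi, j, hj, hij⟩ := Finset.one_lt_card.1 (show 1 < _ from hcard)
  simp only [Finset.mem_filter, Finset.mem_univ, true_and] at hi hj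
  set b := hA.eigenvectorBasis with hb
  obtain ⟨a, c, hac, hsum⟩ : ∃ a c : ℝ, 0 < a ^ 2 + c ^ 2 ∧
      a * (∑ w, b i w) + c * ∑ w, b j w = 0 := by
    by_cases h0 : ∑ w, b i w = 0
    · exact ⟨1, 0, by norm_num, by simp [h0]⟩
    · refine ⟨-∑ w, b j w, ∑ w, b i w, ?_, by ring⟩
      positivity
  have ho : ∀ i j : W, ∑ w, b i w * b j w = if i = j then 1 else 0 := by
    intro i j
    have := orthonormal_iff_ite.1 b.orthonormal i j
    rw [← this, PiLp.inner_apply]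
    simp [mul_comm]
  have hev : ∀ i u, ∑ w, A u w * b i w = hA.eigenvalues i * b i u := by
    intro i u
    have := congrFun (hA.mulVec_eigenvectorBasis i) u
    simpa [Matrix.mulVec, dotProduct] using this
  have hsq : ∑ w, (a * b i w + c * b j w) ^ 2 = a ^ 2 + c ^ 2 := by
    have : ∀ w, (a * b i w + c * b j w) ^ 2 = a ^ 2 * (b i w * b i w)
      + 2 * a * c * (b i w * b j w) + c ^ 2 * (b j w * b j w) := fun w => by ring
    simp only [this, Finset.sum_add_distrib, ← Finset.mul_sum, ho]
    simp [hij]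
  refine ⟨fun w => a * b i w + c * b j w, ?_, ?_, ?_⟩
  · intro h0
    have : ∑ w, (a * b i w + c * b j w) ^ 2 = 0 :=
      Finset.sum_eq_zero fun w _ => by rw [show a * b i w + c * b j w = 0 from congrFun h0 w]; simp
    linarith
  · rw [Finset.sum_add_distrib, ← Finset.mul_sum, ← Finset.mul_sum, hsum]
  · rw [hsq]
    have : ∀ u, ∑ w, (a * b i u + c * b j u) * A u w * (a * b i w + c * b j w)
        = a ^ 2 * hA.eigenvalues i * (b i u * b i u) + a * c * (hA.eigenvalues i + hA.eigenvalues j)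
          * (b i u * b j u) + c ^ 2 * hA.eigenvalues j * (b j u * b j u) := by
      intro u
      have : ∀ w, (a * b i u + c * b j u) * A u w * (a * b i w + c * b j w) =
        (a * b i u + c * b j u) * a * (A u w * b i w) +
        (a * b i u + c * b j u) * c * (A u w * b j w) := fun w => by ring
      simp only [this, Finset.sum_add_distrib, ← Finset.mul_sum, hev]
      ring
    simp only [this, Finset.sum_add_distrib, ← Finset.mul_sum, ho]
    simp only [hij, if_true, if_false]
    nlinarith [mul_le_mul_of_nonneg_left hi (sq_nonneg a), mul_le_mul_of_nonneg_left hj (sq_nonneg c)]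

lemma specC {W : Type} [Fintype W] (A : Matrix W W ℝ)
    (hsymm : ∀ u w, A u w = A w u) (hW : 2 ≤ Fintype.card W) (μ : ℝ)
    (h : μ ≤ secondEig A hsymm) :
    ∃ f : W → ℝ, f ≠ 0 ∧ ∑ w, f w = 0 ∧
      μ * ∑ w, f w ^ 2 ≤ ∑ u, ∑ w, f u * A u w * f w :=
  specC0 _ (Subsingleton.elim _ _) A hsymm hW μ h

lemma addChar_sum {G ι : Type} [AddCommGroup G] (ψ : AddChar G ℂ) (s : Finset ι) (f : ι → G) :
    ψ (∑ i ∈ s, f i) = ∏ i ∈ s, ψ (f i) := by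
  classical
  induction s using Finset.induction_on with
  | empty => simp
  | insert a s ha ih => rw [Finset.sum_insert ha, Finset.prod_insert ha, AddChar.map_add_eq_mul, ih]

/-- The twisted biadjacency matrix. -/
noncomputable def Mmat {F G U W : Type} [AddCommGroup G] [SMul F G] {d : ℕ}
    (ψ : AddChar G ℂ) (ε : U → W → Fin d → F) (a : U → G) (b : W → G) (u : U) (w : W) : ℂ :=
  ∑ j, ψ (ε u w j • (b w - a u))

/-- Linear pairing. -/
noncomputable def pairing {F G V : Type} [Field F] [AddCommGroup G] [Module F G] [Fintype V]
    (c : V → F) : (V → G) →+ G where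
  toFun L := ∑ v, c v • L v
  map_zero' := by simp
  map_add' x y := by simp [Finset.sum_add_distrib]

lemma pairing_add {F G V : Type} [Field F] [AddCommGroup G] [Module F G] [Fintype V]
    (c c' : V → F) (L : V → G) : pairing (c + c') L = pairing c L + pairing c' L := by
  simp [pairing, add_smul, Finset.sum_add_distrib]

lemma pairing_sum {F G V ι : Type} [Field F] [AddCommGroup G] [Module F G] [Fintype V]
    (s : Finset ι) (c : ι → V → F) (L : V → G) :
    pairing (∑ i ∈ s, c i) L = ∑ i ∈ s, pairing (c i) L := by
  simp only [pairing, AddMonoidHom.coe_mk, ZeroHom.coe_mk, Finset.sum_apply, Finset.sum_smul]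
  rw [Finset.sum_comm]

lemma pairing_diff {F G V : Type} [Field F] [AddCommGroup G] [Module F G] [Fintype V]
    [DecidableEq V] (x : F) (v v' : V) (L : V → G) :
    pairing (x • (Pi.single v (1 : F) - Pi.single v' 1 : V → F)) L = x • (L v - L v') := by
  simp [pairing, sub_smul, Pi.single_apply, Finset.sum_sub_distrib, smul_sub, mul_sub]

/-- Index of nonbacktracking closed walks of length four. -/
abbrev PIdx (U W : Type) (d : ℕ) : Type :=
  (U × U) × ({ww : W × W // ww.1 ≠ ww.2} × (Fin d × Fin d × Fin d × Fin d))

/-- Coefficient vector of a closed walk. -/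
def coef {F U W V : Type} [Field F] [DecidableEq V] {d : ℕ} (ε : U → W → Fin d → F)
    (iu : U → V) (iw : W → V) (p : PIdx U W d) : V → F :=
  (-ε p.1.1 p.2.1.1.1 p.2.2.1) • (Pi.single (iw p.2.1.1.1) (1 : F) - Pi.single (iu p.1.1) 1) +
  (ε p.1.1 p.2.1.1.2 p.2.2.2.1) • (Pi.single (iw p.2.1.1.2) (1 : F) - Pi.single (iu p.1.1) 1) +
  (ε p.1.2 p.2.1.1.1 p.2.2.2.2.1) • (Pi.single (iw p.2.1.1.1) (1 : F) - Pi.single (iu p.1.2) 1) +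
  (-ε p.1.2 p.2.1.1.2 p.2.2.2.2.2) • (Pi.single (iw p.2.1.1.2) (1 : F) - Pi.single (iu p.1.2) 1)

/-- The off-diagonal part of the fourth moment. -/
noncomputable def Toff {U W : Type} [Fintype U] [Fintype W] [DecidableEq W] (M : U → W → ℂ) : ℝ :=
  ∑ ww : {ww : W × W // ww.1 ≠ ww.2}, ‖∑ u, (starRingEnd ℂ) (M u ww.1.1) * M u ww.1.2‖ ^ 2

lemma Toff_eq {F G U W V : Type} [Field F] [AddCommGroup G] [Finite G] [Module F G]
    [Fintype U] [Fintype W] [DecidableEq W] [Fintype V] [DecidableEq V] {d : ℕ}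
    (ψ : AddChar G ℂ) (ε : U → W → Fin d → F) (iu : U → V) (iw : W → V) (L : V → G) :
    ((Toff (Mmat ψ ε (fun u => L (iu u)) (fun w => L (iw w))) : ℝ) : ℂ) =
      ∑ p : PIdx U W d, ψ (pairing (coef ε iu iw p) L) := by
  have hc : ∀ p : PIdx U W d, ψ (pairing (coef ε iu iw p) L) =
    (starRingEnd ℂ) (ψ (ε p.1.1 p.2.1.1.1 p.2.2.1 • (L (iw p.2.1.1.1) - L (iu p.1.1)))) *
    ψ (ε p.1.1 p.2.1.1.2 p.2.2.2.1 • (L (iw p.2.1.1.2) - L (iu p.1.1))) *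
    (ψ (ε p.1.2 p.2.1.1.1 p.2.2.2.2.1 • (L (iw p.2.1.1.1) - L (iu p.1.2))) *
    (starRingEnd ℂ) (ψ (ε p.1.2 p.2.1.1.2 p.2.2.2.2.2 • (L (iw p.2.1.1.2) - L (iu p.1.2))))) := by
    intro p
    simp only [coef, pairing_add, pairing_diff, AddChar.map_add_eq_mul, neg_smul (_ : F) (_ : G),
      AddChar.map_neg_eq_conj]
    ring
  unfold Toff
  push_cast
  rw [Fintype.sum_prod_type, Finset.sum_comm, Fintype.sum_prod_type]
  refine Finset.sum_congr rfl fun ww _ => ?_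
  rw [← Complex.mul_conj']
  have h4 : ∀ A B C E : Fin d → ℂ, ∑ j : Fin d × Fin d × Fin d × Fin d,
      A j.1 * B j.2.1 * (C j.2.2.1 * E j.2.2.2) =
      (∑ j, A j) * (∑ j, B j) * ((∑ j, C j) * ∑ j, E j) := by
    intro A B C E
    simp only [Fintype.sum_prod_type, ← Finset.mul_sum, ← Finset.sum_mul]
  rw [map_sum, Finset.sum_mul_sum]
  conv_rhs => rw [Finset.sum_comm, Fintype.sum_prod_type]
  refine Finset.sum_congr rfl fun u _ => Finset.sum_congr rfl fun u' _ => ?_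
  simp only [hc]
  rw [h4 (fun j => (starRingEnd ℂ) (ψ (ε u ww.1.1 j • (L (iw ww.1.1) - L (iu u)))))
    (fun j => ψ (ε u ww.1.2 j • (L (iw ww.1.2) - L (iu u))))
    (fun j => ψ (ε u' ww.1.1 j • (L (iw ww.1.1) - L (iu u'))))
    (fun j => (starRingEnd ℂ) (ψ (ε u' ww.1.2 j • (L (iw ww.1.2) - L (iu u')))))]
  simp only [Mmat, map_sum, map_mul, Complex.conj_conj]

lemma count_good {U : Type} [Fintype U] [DecidableEq U] (k : ℕ) (hk : 1 ≤ k) :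
    (Finset.univ.filter (fun s : Fin k × Bool → U => ∀ x, ∃ y, y ≠ x ∧ s y = s x)).card
      ≤ Fintype.card U ^ k * k ^ (2 * k) := by
  have hne : Nonempty (Fin k) := ⟨⟨0, hk⟩⟩
  have hsub : (Finset.univ.filter (fun s : Fin k × Bool → U => ∀ x, ∃ y, y ≠ x ∧ s y = s x)) ⊆
      (Finset.univ : Finset ((Fin k → U) × (Fin k × Bool → Fin k))).image
        (fun gh => gh.1 ∘ gh.2) := by
    intro s hs
    simp only [Finset.mem_filter, Finset.mem_univ, true_and] at hs
    simp only [Finset.mem_image, Finset.mem_univ, true_and]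
    have hI : (Finset.univ.image s).card ≤ k := by
      have h1 : (Finset.univ.image s).card * 2 ≤ (Finset.univ : Finset (Fin k × Bool)).card := by
        rw [Finset.card_eq_sum_card_image s Finset.univ, ← smul_eq_mul]
        refine Finset.card_nsmul_le_sum _ _ _ ?_
        intro u hu
        obtain ⟨x, -, rfl⟩ := Finset.mem_image.1 hu
        obtain ⟨y, hy, hsy⟩ := hs x
        exact Finset.one_lt_card.2 ⟨y, by simp [hsy], x, by simp, hy⟩
      simp at h1
      omega
    have : Fintype.card ↥(Finset.univ.image s) ≤ Fintype.card (Fin k) := by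
      rw [Fintype.card_coe, Fintype.card_fin]; exact hI
    obtain ⟨em⟩ := Function.Embedding.nonempty_of_card_le this
    have hneI : Nonempty ↥(Finset.univ.image s) :=
      ⟨⟨s (hne.some, true), Finset.mem_image_of_mem _ (Finset.mem_univ _)⟩⟩
    refine ⟨⟨fun i => ((Function.invFun em i : ↥(Finset.univ.image s)) : U),
      fun x => em ⟨s x, Finset.mem_image_of_mem _ (Finset.mem_univ _)⟩⟩, ?_⟩
    funext x
    simp [Function.leftInverse_invFun em.injective _]
  refine (Finset.card_le_card hsub).trans (Finset.card_image_le.trans ?_)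
  simp [mul_comm]

lemma coef_good {F U W V : Type} [Field F] [DecidableEq V] {d k : ℕ} (ε : U → W → Fin d → F)
    (hε : ∀ u w w' j j', ε u w j = ε u w' j' → w = w')
    (iu : U → V) (iw : W → V) (hiu : Function.Injective iu) (hd : ∀ u w, iu u ≠ iw w)
    (p : Fin k → PIdx U W d) (hp : ∑ i, coef ε iu iw (p i) = 0) :
    ∀ x : Fin k × Bool, ∃ y, y ≠ x ∧
      (fun z : Fin k × Bool => if z.2 then (p z.1).1.2 else (p z.1).1.1) y =
      (fun z : Fin k × Bool => if z.2 then (p z.1).1.2 else (p z.1).1.1) x := by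
  classical
  rintro ⟨i, b⟩
  by_contra hcon
  push Not at hcon
  have hval : ∀ (q : PIdx U W d) (u : U), coef ε iu iw q (iu u) =
      (if q.1.1 = u then ε q.1.1 q.2.1.1.1 q.2.2.1 - ε q.1.1 q.2.1.1.2 q.2.2.2.1 else 0) +
      (if q.1.2 = u then ε q.1.2 q.2.1.1.2 q.2.2.2.2.2 - ε q.1.2 q.2.1.1.1 q.2.2.2.2.1 else 0) := by
    intro q u
    simp only [coef, Pi.add_apply, Pi.smul_apply, Pi.sub_apply, Pi.single_apply, hd, if_false,
      smul_eq_mul, hiu.eq_iff, eq_comm (a := u)]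
    split_ifs <;> ring
  have hne : ∀ (q : PIdx U W d) , ε q.1.1 q.2.1.1.1 q.2.2.1 - ε q.1.1 q.2.1.1.2 q.2.2.2.1 ≠ 0 ∧
      ε q.1.2 q.2.1.1.2 q.2.2.2.2.2 - ε q.1.2 q.2.1.1.1 q.2.2.2.2.1 ≠ 0 := by
    intro q
    refine ⟨fun h => q.2.1.2 (hε _ _ _ _ _ (sub_eq_zero.1 h)),
      fun h => q.2.1.2 (hε _ _ _ _ _ (sub_eq_zero.1 h)).symm⟩
  cases b
  · have h0 := congrFun hp (iu (p i).1.1)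
    rw [Finset.sum_apply, Finset.sum_eq_single i] at h0
    · rw [hval] at h0
      have h2 := hcon ⟨i, true⟩ (by simp)
      simp only [if_true, Bool.false_eq_true, if_false] at h2
      simp [h2] at h0
      exact (hne (p i)).1 h0
    · intro i' _ hi'
      have h1 := hcon ⟨i', false⟩ (by simp [hi'])
      have h2 := hcon ⟨i', true⟩ (by simp)
      simp only [if_true, Bool.false_eq_true, if_false] at h1 h2
      rw [hval]; simp [h1, h2]
    · simp
  · have h0 := congrFun hp (iu (p i).1.2)
    rw [Finset.sum_apply, Finset.sum_eq_single i] at h0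
    · rw [hval] at h0
      have h2 := hcon ⟨i, false⟩ (by simp)
      simp only [if_true, Bool.false_eq_true, if_false] at h2
      simp [h2] at h0
      exact (hne (p i)).2 h0
    · intro i' _ hi'
      have h1 := hcon ⟨i', false⟩ (by simp)
      have h2 := hcon ⟨i', true⟩ (by simp [hi'])
      simp only [if_true, Bool.false_eq_true, if_false] at h1 h2
      rw [hval]; simp [h1, h2]
    · simp

lemma count_zero {F U W V : Type} [Field F] [DecidableEq F] [Fintype U] [Fintype W] [DecidableEq U]
    [DecidableEq W] [Fintype V]
    [DecidableEq V] {d k n : ℕ} (hk : 1 ≤ k) (ε : U → W → Fin d → F)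
    (hε : ∀ u w w' j j', ε u w j = ε u w' j' → w = w')
    (iu : U → V) (iw : W → V) (hiu : Function.Injective iu) (hd : ∀ u w, iu u ≠ iw w)
    (hU : Fintype.card U = n) (hW : Fintype.card W = n) :
    (Finset.univ.filter (fun p : Fin k → PIdx U W d => ∑ i, coef ε iu iw (p i) = 0)).card
      ≤ n ^ k * k ^ (2 * k) * (n ^ 2 * d ^ 4) ^ k := by
  have h1 : (Finset.univ.filter (fun p : Fin k → PIdx U W d => ∑ i, coef ε iu iw (p i) = 0)).card ≤
      ((Finset.univ.filter (fun s : Fin k × Bool → U => ∀ x, ∃ y, y ≠ x ∧ s y = s x)) ×ˢ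
      (Finset.univ : Finset (Fin k → ({ww : W × W // ww.1 ≠ ww.2} ×
        (Fin d × Fin d × Fin d × Fin d))))).card := by
    refine Finset.card_le_card_of_injOn
      (fun p => (fun z : Fin k × Bool => if z.2 then (p z.1).1.2 else (p z.1).1.1,
        fun i => (p i).2)) ?_ ?_
    · intro p hp
      simp only [Finset.coe_filter, Finset.mem_univ, true_and, Set.mem_ofPred_eq] at hp
      simp only [Finset.coe_product, Set.mem_prod, Finset.mem_coe, Finset.mem_filter,
        Finset.mem_univ, true_and, and_true]
      exact coef_good ε hε iu iw hiu hd p hp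
    · intro p _ p' _ h
      simp only [Prod.mk.injEq] at h
      funext i
      have a1 := congrFun h.1 (i, false)
      have a2 := congrFun h.1 (i, true)
      have a3 := congrFun h.2 i
      simp only [if_true, Bool.false_eq_true, if_false] at a1 a2
      exact Prod.ext (Prod.ext a1 a2) a3
  refine h1.trans ?_
  rw [Finset.card_product]
  refine Nat.mul_le_mul ((count_good k hk).trans (by rw [hU])) ?_
  rw [Finset.card_univ, Fintype.card_fun, Fintype.card_fin]
  refine Nat.pow_le_pow_left ?_ _
  rw [Fintype.card_prod]
  refine Nat.mul_le_mul ?_ ?_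
  · refine (Fintype.card_subtype_le _).trans ?_
    simp [hW, sq]
  · simp; apply le_of_eq; ring

lemma card_all {U W : Type} [Fintype U] [Fintype W] [DecidableEq W] {d k n : ℕ}
    (hU : Fintype.card U = n) (hW : Fintype.card W = n) :
    Fintype.card (Fin k → PIdx U W d) ≤ (n * d) ^ (4 * k) := by
  rw [Fintype.card_fun, Fintype.card_fin, pow_mul]
  refine Nat.pow_le_pow_left ?_ _
  rw [Fintype.card_prod, Fintype.card_prod]
  have : Fintype.card {ww : W × W // ww.1 ≠ ww.2} ≤ n * n :=
    (Fintype.card_subtype_le _).trans (by simp [hW])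
  calc _ ≤ (n * n) * ((n * n) * (d * (d * (d * d)))) := by
        simp only [Fintype.card_prod, hU, Fintype.card_fin]
        gcongr
    _ = _ := by ring

lemma momentD {F G U W V : Type} [Field F] [DecidableEq F] [AddCommGroup G] [Fintype G] [Module F G]
    [Fintype U] [Fintype W] [DecidableEq U] [DecidableEq W] [Fintype V] [DecidableEq V]
    {d k n : ℕ} (hk : 1 ≤ k)
    (ψ : AddChar G ℂ) (hψ : ∃ z, ψ z ≠ 1) (ε : U → W → Fin d → F)
    (hε : ∀ u w w' j j', ε u w j = ε u w' j' → w = w')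
    (iu : U → V) (iw : W → V) (hiu : Function.Injective iu) (hd : ∀ u w, iu u ≠ iw w)
    (hU : Fintype.card U = n) (hW : Fintype.card W = n)
    (D : (V → G) → ℝ) (hD0 : ∀ L, 0 ≤ D L) (hD1 : ∑ L, D L = 1) (β : ℝ) (hβ : 0 ≤ β)
    (hbias : ∀ χ : AddChar (V → G) ℂ, (∃ z, χ z ≠ 1) → ‖∑ L, (D L : ℂ) * χ L‖ ≤ β) :
    ∑ L, D L * Toff (Mmat ψ ε (fun u => L (iu u)) (fun w => L (iw w))) ^ k ≤
      (n : ℝ) ^ k * (k : ℝ) ^ (2 * k) * ((n : ℝ) ^ 2 * (d : ℝ) ^ 4) ^ k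
        + β * ((n : ℝ) * d) ^ (4 * k) := by
  set S := ∑ L, D L * Toff (Mmat ψ ε (fun u => L (iu u)) (fun w => L (iw w))) ^ k with hS
  have e : (S : ℂ) = ∑ p : Fin k → PIdx U W d, ∑ L, (D L : ℂ) *
      ψ (pairing (∑ i, coef ε iu iw (p i)) L) := by
    rw [Finset.sum_comm, hS]
    push_cast
    refine Finset.sum_congr rfl fun L _ => ?_
    rw [Toff_eq, Fintype.sum_pow, Finset.mul_sum]
    refine Finset.sum_congr rfl fun p _ => ?_
    rw [pairing_sum, addChar_sum]
  have hterm : ∀ p : Fin k → PIdx U W d, ‖∑ L, (D L : ℂ) *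
      ψ (pairing (∑ i, coef ε iu iw (p i)) L)‖ ≤
      (if ∑ i, coef ε iu iw (p i) = 0 then 1 else 0) + β := by
    intro p
    by_cases h0 : ∑ i, coef ε iu iw (p i) = 0
    · rw [if_pos h0]
      refine (norm_sum_le _ _).trans ?_
      have : ∀ L, ‖(D L : ℂ) * ψ (pairing (∑ i, coef ε iu iw (p i)) L)‖ = D L := by
        intro L
        rw [norm_mul, AddChar.norm_apply, mul_one, Complex.norm_real, Real.norm_of_nonneg (hD0 L)]
      simp only [this, hD1]
      linarith
    · rw [if_neg h0, zero_add]
      refine hbias (ψ.compAddMonoidHom (pairing (∑ i, coef ε iu iw (p i)))) ?_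
      obtain ⟨v, hv⟩ := Function.ne_iff.1 h0
      obtain ⟨z, hz⟩ := hψ
      set c := ∑ i, coef ε iu iw (p i) with hc
      refine ⟨Pi.single v ((c v)⁻¹ • z), ?_⟩
      have : pairing c (Pi.single v ((c v)⁻¹ • z)) = z := by
        simp only [pairing, AddMonoidHom.coe_mk, ZeroHom.coe_mk]
        rw [Finset.sum_eq_single v]
        · rw [Pi.single_eq_same, smul_smul, mul_inv_cancel₀ (by simpa using hv), one_smul]
        · intro b _ hb; rw [Pi.single_eq_of_ne hb, smul_zero]
        · simp
      rw [AddChar.compAddMonoidHom_apply, this]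
      exact hz
  have h1 : S ≤ ‖(S : ℂ)‖ := by rw [Complex.norm_real]; exact le_abs_self S
  refine h1.trans ?_
  rw [e]
  refine (norm_sum_le _ _).trans ((Finset.sum_le_sum fun p _ => hterm p).trans ?_)
  rw [Finset.sum_add_distrib, Finset.sum_boole, Finset.sum_const, nsmul_eq_mul, Finset.card_univ,
    mul_comm _ β]
  have a1 := count_zero (k := k) hk ε hε iu iw hiu hd hU hW
  have a2 := card_all (k := k) (d := d) hU hW
  refine add_le_add ?_ (mul_le_mul_of_nonneg_left ?_ hβ)
  · exact_mod_cast a1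
  · exact_mod_cast a2

/-- Fourier transform of a real function. -/
noncomputable def ft {G : Type} [AddCommGroup G] [Fintype G] (g : G → ℝ) (ψ : AddChar G ℂ) : ℂ :=
  ∑ y, (g y : ℂ) * ψ y

lemma ft_corr {G : Type} [AddCommGroup G] [Fintype G] (g h : G → ℝ) (a b : G) :
    ∑ ψ : AddChar G ℂ, (starRingEnd ℂ) (ft g ψ) * ψ (b - a) * ft h ψ =
      (((Fintype.card G : ℝ) * ∑ x, g (x - a) * h (x - b) : ℝ) : ℂ) := by
  classical
  have h1 : ∀ ψ : AddChar G ℂ, (starRingEnd ℂ) (ft g ψ) * ψ (b - a) * ft h ψ =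
      ∑ x, ∑ y, (g x : ℂ) * h y * ψ (y - x + (b - a)) := by
    intro ψ
    simp only [ft, map_sum, map_mul, Complex.conj_ofReal, Finset.sum_mul, Finset.mul_sum]
    rw [Finset.sum_comm]
    refine Finset.sum_congr rfl fun x _ => Finset.sum_congr rfl fun y _ => ?_
    rw [AddChar.map_add_eq_mul, sub_eq_add_neg y x, AddChar.map_add_eq_mul,
      AddChar.map_neg_eq_conj]
    ring
  simp only [h1]
  rw [Finset.sum_comm]
  have h2 : ∀ x, ∑ ψ : AddChar G ℂ, ∑ y, (g x : ℂ) * h y * ψ (y - x + (b - a)) =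
      (g x : ℂ) * h (x + a - b) * (Fintype.card G : ℂ) := by
    intro x
    rw [Finset.sum_comm]
    simp only [← Finset.mul_sum, AddChar.sum_apply_eq_ite]
    rw [Finset.sum_eq_single (x + a - b)]
    · rw [if_pos (by abel)]
    · intro y _ hy
      rw [if_neg, mul_zero]
      intro h0
      apply hy
      have : y = (y - x + (b - a)) + (x + a - b) := by abel
      rw [this, h0, zero_add]
    · simp
  simp only [h2]
  push_cast
  rw [Finset.mul_sum]
  rw [← Equiv.sum_comp (Equiv.subRight a)]
  refine Finset.sum_congr rfl fun x _ => ?_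
  simp only [Equiv.subRight_apply, sub_add_cancel]
  ring

lemma ft_parseval {G : Type} [AddCommGroup G] [Fintype G] (g : G → ℝ) :
    ∑ ψ : AddChar G ℂ, ‖ft g ψ‖ ^ 2 = (Fintype.card G : ℝ) * ∑ x, g x ^ 2 := by
  have := ft_corr g g 0 0
  have h2 : ((∑ ψ : AddChar G ℂ, ‖ft g ψ‖ ^ 2 : ℝ) : ℂ) =
      (((Fintype.card G : ℝ) * ∑ x, g x ^ 2 : ℝ) : ℂ) := by
    simp only [sub_zero, AddChar.map_zero_eq_one, mul_one, Complex.conj_mul', ← sq] at this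
    rw [← this]
    push_cast
    rfl
  exact_mod_cast h2

lemma fourierE {F G U W : Type} [Field F] [AddCommGroup G] [Fintype G] [Module F G]
    [Fintype U] [Fintype W] {d : ℕ} (ε : U → W → Fin d → F) (a : U → G) (b : W → G)
    (g : U → G → ℝ) (h : W → G → ℝ) (μ : ℝ) (hμ : 0 < μ)
    (hsum : ∑ u, ∑ y, g u y + ∑ w, ∑ y, h w y = 0)
    (hpos : 0 < ∑ u, ∑ y, g u y ^ 2 + ∑ w, ∑ y, h w y ^ 2)
    (hq : μ * (∑ u, ∑ y, g u y ^ 2 + ∑ w, ∑ y, h w y ^ 2) ≤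
      2 * ∑ u, ∑ w, ∑ j, ∑ x, g u (x - ε u w j • a u) * h w (x - ε u w j • b w)) :
    ∃ ψ : AddChar G ℂ, ψ ≠ 0 ∧ μ ^ 4 ≤
      ∑ w, ∑ w', ‖∑ u, (starRingEnd ℂ) (Mmat ψ ε a b u w) * Mmat ψ ε a b u w'‖ ^ 2 := by
  by_contra hcon
  push Not at hcon
  set P : AddChar G ℂ → ℝ := fun ψ => ∑ u, ‖ft (g u) ψ‖ ^ 2 + ∑ w, ‖ft (h w) ψ‖ ^ 2 with hP
  set Z : AddChar G ℂ → ℂ := fun ψ =>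
    ∑ u, ∑ w, (starRingEnd ℂ) (ft (g u) ψ) * Mmat ψ ε a b u w * ft (h w) ψ with hZ
  have hPsum : ∑ ψ, P ψ = (Fintype.card G : ℝ) *
      (∑ u, ∑ y, g u y ^ 2 + ∑ w, ∑ y, h w y ^ 2) := by
    simp only [hP, Finset.sum_add_distrib]
    have e1 : ∑ ψ : AddChar G ℂ, ∑ u, ‖ft (g u) ψ‖ ^ 2 =
        (Fintype.card G : ℝ) * ∑ u, ∑ y, g u y ^ 2 := by
      rw [Finset.sum_comm]
      simp only [ft_parseval, ← Finset.mul_sum]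
    have e2 : ∑ ψ : AddChar G ℂ, ∑ w, ‖ft (h w) ψ‖ ^ 2 =
        (Fintype.card G : ℝ) * ∑ w, ∑ y, h w y ^ 2 := by
      rw [Finset.sum_comm]
      simp only [ft_parseval, ← Finset.mul_sum]
    rw [e1, e2]
    ring
  have hZsum : ∑ ψ, Z ψ = (((Fintype.card G : ℝ) *
      ∑ u, ∑ w, ∑ j, ∑ x, g u (x - ε u w j • a u) * h w (x - ε u w j • b w) : ℝ) : ℂ) := by
    have e : ∀ u w j, (((Fintype.card G : ℝ) *
        ∑ x, g u (x - ε u w j • a u) * h w (x - ε u w j • b w) : ℝ) : ℂ) =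
        ∑ ψ : AddChar G ℂ, (starRingEnd ℂ) (ft (g u) ψ) * ψ (ε u w j • (b w - a u)) *
          ft (h w) ψ := by
      intro u w j
      rw [smul_sub, ft_corr]
    have e' : (Fintype.card G : ℝ) *
        ∑ u, ∑ w, ∑ j, ∑ x, g u (x - ε u w j • a u) * h w (x - ε u w j • b w) =
        ∑ u, ∑ w, ∑ j, (Fintype.card G : ℝ) *
          ∑ x, g u (x - ε u w j • a u) * h w (x - ε u w j • b w) := by
      rw [Finset.mul_sum]
      refine Finset.sum_congr rfl fun u _ => ?_
      rw [Finset.mul_sum]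
      refine Finset.sum_congr rfl fun w _ => ?_
      rw [Finset.mul_sum]
    rw [e']
    rw [Complex.ofReal_sum]
    simp_rw [Complex.ofReal_sum Finset.univ (fun w => ∑ j, _),
      Complex.ofReal_sum Finset.univ (fun j : Fin d => _)]
    simp_rw [e]
    simp only [hZ, Mmat, Finset.mul_sum, Finset.sum_mul]
    rw [Finset.sum_comm]
    refine Finset.sum_congr rfl fun u _ => ?_
    rw [Finset.sum_comm]
    refine Finset.sum_congr rfl fun w _ => ?_
    rw [Finset.sum_comm]
  have hcard : (0 : ℝ) < Fintype.card G := by exact_mod_cast Fintype.card_pos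
  have hlt : ∀ ψ, 0 < P ψ → 2 * (Z ψ).re < μ * P ψ := by
    intro ψ hp
    by_cases h0 : ψ = 0
    · refine lt_of_le_of_lt ?_ (mul_pos hμ hp)
      subst h0
      set A : ℝ := ∑ u, ∑ y, g u y with hA
      set B : ℝ := ∑ w, ∑ y, h w y with hB
      have e : Z 0 = ((A * d * B : ℝ) : ℂ) := by
        simp only [hZ, ft, Mmat, AddChar.zero_apply, mul_one, ← Complex.ofReal_sum,
          Complex.conj_ofReal, Finset.sum_const, Finset.card_univ, Fintype.card_fin, nsmul_eq_mul,
          ← Finset.mul_sum, ← Finset.sum_mul]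
        rw [hA, hB]
        push_cast
        rfl
      rw [e, Complex.ofReal_re]
      have : B = -A := by linarith
      rw [this]
      have : 0 ≤ A ^ 2 * d := by positivity
      nlinarith
    · by_contra hc
      push Not at hc
      exact absurd (matB (Mmat ψ ε a b) (fun u => ft (g u) ψ) (fun w => ft (h w) ψ) μ hμ hp hc)
        (not_le.2 (hcon ψ h0))
  have hP0 : ∀ ψ, 0 ≤ P ψ := fun ψ => by simp only [hP]; positivity
  have hle : ∀ ψ, 2 * (Z ψ).re ≤ μ * P ψ := by
    intro ψ
    rcases (hP0 ψ).lt_or_eq with h1 | h1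
    · exact (hlt ψ h1).le
    · rw [← h1, mul_zero]
      have hx : ∑ u, ‖ft (g u) ψ‖ ^ 2 = 0 := by
        have : 0 ≤ ∑ u, ‖ft (g u) ψ‖ ^ 2 := by positivity
        have : 0 ≤ ∑ w, ‖ft (h w) ψ‖ ^ 2 := by positivity
        simp only [hP] at h1
        linarith
      rw [Finset.sum_eq_zero_iff_of_nonneg (fun _ _ => by positivity)] at hx
      have : Z ψ = 0 := by
        simp only [hZ]
        refine Finset.sum_eq_zero fun u hu => Finset.sum_eq_zero fun w _ => ?_
        have : ft (g u) ψ = 0 := by simpa using hx u hu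
        simp [this]
      simp [this]
  obtain ⟨ψ, -, hψ⟩ : ∃ ψ ∈ (Finset.univ : Finset (AddChar G ℂ)), 0 < P ψ := by
    apply Finset.exists_lt_of_sum_lt
    rw [hPsum]
    simp only [Finset.sum_const_zero]
    positivity
  have hs : ∑ ψ, 2 * (Z ψ).re < ∑ ψ, μ * P ψ :=
    Finset.sum_lt_sum (fun ψ _ => hle ψ) ⟨ψ, Finset.mem_univ _, hlt ψ hψ⟩
  rw [← Finset.mul_sum, ← Finset.mul_sum, ← Complex.re_sum, hZsum, Complex.ofReal_re, hPsum] at hs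
  nlinarith [mul_le_mul_of_nonneg_left hq hcard.le]

lemma adj_quad {V E : Type} [Fintype V] [Fintype E] (v0 v1 : E → V) (hne : ∀ e, v0 e ≠ v1 e)
    (f : V → ℝ) :
    ∑ u, ∑ w, f u * adjMat v0 v1 u w * f w = 2 * ∑ e, f (v0 e) * f (v1 e) := by
  classical
  have hA : ∀ u w, adjMat v0 v1 u w = ∑ e, ((if v0 e = u ∧ v1 e = w then (1 : ℝ) else 0) +
      (if v1 e = u ∧ v0 e = w then 1 else 0)) := by
    intro u w
    unfold adjMat
    rw [Nat.card_eq_fintype_card, Fintype.card_subtype, ← Finset.sum_boole]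
    refine Finset.sum_congr rfl fun e _ => ?_
    by_cases h1 : v0 e = u ∧ v1 e = w
    · by_cases h2 : v1 e = u ∧ v0 e = w
      · exact absurd (h1.1.trans h2.1.symm) (hne e)
      · rw [if_pos (Or.inl h1), if_pos h1, if_neg h2, add_zero]
    · rw [if_neg h1, zero_add]
      simp only [h1, false_or]
  have hu : ∀ u w, f u * adjMat v0 v1 u w * f w = ∑ e,
      ((if v0 e = u then if v1 e = w then f u * f w else 0 else 0) +
      (if v1 e = u then if v0 e = w then f u * f w else 0 else 0)) := by
    intro u w
    rw [hA, Finset.mul_sum, Finset.sum_mul]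
    refine Finset.sum_congr rfl fun e _ => ?_
    rw [mul_add, add_mul]
    congr 1
    · rw [ite_and]
      split_ifs <;> simp
    · rw [ite_and]
      split_ifs <;> simp
  simp only [hu]
  have : ∀ u, ∑ w, ∑ e, ((if v0 e = u then if v1 e = w then f u * f w else 0 else 0) +
      (if v1 e = u then if v0 e = w then f u * f w else 0 else 0)) =
      ∑ e, ((if v0 e = u then f u * f (v1 e) else 0) + (if v1 e = u then f u * f (v0 e) else 0)) := by
    intro u
    rw [Finset.sum_comm]
    refine Finset.sum_congr rfl fun e _ => ?_
    rw [Finset.sum_add_distrib]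
    congr 1
    · split_ifs <;> simp
    · split_ifs <;> simp
  simp only [this]
  rw [Finset.sum_comm, Finset.mul_sum]
  refine Finset.sum_congr rfl fun e _ => ?_
  rw [Finset.sum_add_distrib]
  simp
  ring

/-- Parametrization of the vertices of the lifted graph. -/
def liftMk (F : Type) [Field F] (t : ℕ) {V : Type} (L : V → Fin t → F)
    (p : V × (Fin t → F)) : LiftedVertex F t L :=
  ⟨p.1, Submodule.Quotient.mk ((0 : F), p.2)⟩

lemma lift_bij (F : Type) [Field F] (t : ℕ) {V : Type} (L : V → Fin t → F) :
    Function.Bijective (liftMk F t L) := by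
  constructor
  · rintro ⟨v, y⟩ ⟨v', y'⟩ h
    unfold liftMk LiftedVertex at h
    rw [Sigma.mk.injEq] at h
    obtain ⟨hv, h⟩ := h
    simp only at hv
    subst hv
    have h := eq_of_heq h
    rw [Submodule.Quotient.eq, Submodule.mem_span_singleton] at h
    obtain ⟨c, hc⟩ := h
    have h1 := congrArg Prod.fst hc
    have h2 := congrArg Prod.snd hc
    simp at h1
    simp [h1] at h2
    rw [Prod.mk.injEq]
    exact ⟨rfl, (sub_eq_zero.1 h2.symm)⟩
  · rintro ⟨v, c⟩
    obtain ⟨⟨e, x⟩, rfl⟩ := Submodule.Quotient.mk_surjective _ c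
    refine ⟨⟨v, x - e • L v⟩, ?_⟩
    simp only [liftMk]
    congr 1
    rw [Submodule.Quotient.eq, Submodule.mem_span_singleton]
    refine ⟨-e, ?_⟩
    ext <;> simp

lemma lift_mk (F : Type) [Field F] (t : ℕ) {V : Type} (L : V → Fin t → F) (v : V) (e : F)
    (x : Fin t → F) :
    (⟨v, Submodule.Quotient.mk (e, x)⟩ : LiftedVertex F t L) =
      liftMk F t L (v, x - e • L v) := by
  unfold liftMk
  congr 1
  rw [Submodule.Quotient.eq, Submodule.mem_span_singleton]
  refine ⟨e, ?_⟩
  ext <;> simp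

lemma liftH (F : Type) [Field F] [Fintype F] (t : ℕ)
    {V : Type} [Fintype V] [DecidableEq V]
    (V0 V1 : Finset V) (hdisj : Disjoint V0 V1) (hcover : V0 ∪ V1 = Finset.univ)
    (hV : 2 ≤ Fintype.card V)
    (E : Finset F) (v0 v1 : ↥E → V) (hne : ∀ e, v0 e ≠ v1 e) {d : ℕ}
    (ee : ↥V0 → ↥V1 → Fin d → ↥E)
    (hee : Function.Bijective (fun z : ↥V0 × ↥V1 × Fin d => ee z.1 z.2.1 z.2.2))
    (he0 : ∀ u w j, v0 (ee u w j) = u) (he1 : ∀ u w j, v1 (ee u w j) = w)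
    (L : V → Fin t → F) (μ : ℝ) (hμ : 0 < μ) (h : μ ≤ lambda2Lifted F t E v0 v1 L) :
    ∃ ψ : AddChar (Fin t → F) ℂ, ψ ≠ 0 ∧ μ ^ 4 ≤
      ∑ w, ∑ w', ‖∑ u, (starRingEnd ℂ) (Mmat ψ (fun u w j => (ee u w j : F))
        (fun u : ↥V0 => L u) (fun w : ↥V1 => L w) u w) *
        Mmat ψ (fun u w j => (ee u w j : F))
        (fun u : ↥V0 => L u) (fun w : ↥V1 => L w) u w'‖ ^ 2 := by
  classical
  let : Fintype (LiftedVertex F t L) := Fintype.ofFinite _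
  have hb := lift_bij F t L
  set φ : V × (Fin t → F) → LiftedVertex F t L := liftMk F t L with hφ
  have hcard : 2 ≤ Fintype.card (LiftedVertex F t L) := by
    rw [← Fintype.card_of_bijective hb, Fintype.card_prod]
    have : 1 ≤ Fintype.card (Fin t → F) := Fintype.card_pos
    nlinarith
  obtain ⟨f, hf0, hfs, hfq⟩ := specC _ (adjMat_symm _ _) hcard μ h
  have hsplit : ∀ r : LiftedVertex F t L → ℝ, ∑ p, r p =
      ∑ u : ↥V0, ∑ y, r (φ (u, y)) + ∑ w : ↥V1, ∑ y, r (φ (w, y)) := by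
    intro r
    rw [← hb.sum_comp r, Fintype.sum_prod_type, ← hcover, Finset.sum_union hdisj,
      Finset.sum_coe_sort V0 (fun v => ∑ y, r (φ (v, y))),
      Finset.sum_coe_sort V1 (fun v => ∑ y, r (φ (v, y)))]
  refine fourierE (fun u w j => (ee u w j : F)) (fun u : ↥V0 => L u) (fun w : ↥V1 => L w)
    (fun u y => f (φ (u, y))) (fun w y => f (φ (w, y))) μ hμ ?_ ?_ ?_
  · rw [← hsplit f, hfs]
  · rw [← hsplit (fun p => f p ^ 2)]
    obtain ⟨p, hp⟩ := Function.ne_iff.1 hf0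
    refine Finset.sum_pos' (fun _ _ => by positivity) ⟨p, Finset.mem_univ _, ?_⟩
    have : f p ≠ 0 := hp
    positivity
  · rw [← hsplit (fun p => f p ^ 2)]
    refine hfq.trans (le_of_eq ?_)
    rw [adj_quad]
    · congr 1
      rw [Fintype.sum_prod_type, ← hee.sum_comp, Fintype.sum_prod_type]
      refine Finset.sum_congr rfl fun u _ => ?_
      rw [Fintype.sum_prod_type]
      refine Finset.sum_congr rfl fun w _ => Finset.sum_congr rfl fun j _ =>
        Finset.sum_congr rfl fun x _ => ?_
      simp only [liftedEnd, hφ]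
      rw [lift_mk, lift_mk, he0, he1]
    · intro e heq
      exact hne e.1 (congrArg Sigma.fst heq)

lemma exists_edges {F V : Type} [Field F] {d : ℕ} (V0 V1 : Finset V) (E : Finset F)
    (v0 v1 : ↥E → V) (hb0 : ∀ e, v0 e ∈ V0) (hb1 : ∀ e, v1 e ∈ V1)
    (hcomplete : ∀ u ∈ V0, ∀ w ∈ V1, Nat.card {e : ↥E // v0 e = u ∧ v1 e = w} = d) :
    ∃ ee : ↥V0 → ↥V1 → Fin d → ↥E,
      Function.Bijective (fun z : ↥V0 × ↥V1 × Fin d => ee z.1 z.2.1 z.2.2) ∧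
      (∀ u w j, v0 (ee u w j) = u) ∧ (∀ u w j, v1 (ee u w j) = w) := by
  classical
  have h : ∀ (u : ↥V0) (w : ↥V1), Nonempty ({e : ↥E // v0 e = u ∧ v1 e = w} ≃ Fin d) := by
    intro u w
    have := hcomplete u u.2 w w.2
    exact ⟨Finite.equivFinOfCardEq this⟩
  let eq := fun u w => (h u w).some
  refine ⟨fun u w j => ((eq u w).symm j).1, ⟨?_, ?_⟩, fun u w j => ((eq u w).symm j).2.1,
    fun u w j => ((eq u w).symm j).2.2⟩
  · rintro ⟨u, w, j⟩ ⟨u', w', j'⟩ hh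
    simp only at hh
    have a1 := ((eq u w).symm j).2
    have a2 := ((eq u' w').symm j').2
    rw [hh] at a1
    obtain rfl : u = u' := Subtype.ext (a1.1.symm.trans a2.1)
    obtain rfl : w = w' := Subtype.ext (a1.2.symm.trans a2.2)
    have := (eq u w).symm.injective (Subtype.ext hh)
    rw [this]
  · intro e
    refine ⟨⟨⟨v0 e, hb0 e⟩, ⟨v1 e, hb1 e⟩, eq ⟨v0 e, hb0 e⟩ ⟨v1 e, hb1 e⟩ ⟨e, rfl, rfl⟩⟩, ?_⟩
    simp

lemma Tdiag_bound {F G U W : Type} [AddCommGroup G] [Finite G] [SMul F G] [Fintype U] [Fintype W]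
    [DecidableEq W] {d n : ℕ} (hU : Fintype.card U = n) (hW : Fintype.card W = n)
    (ψ : AddChar G ℂ) (ε : U → W → Fin d → F) (a : U → G) (b : W → G) :
    ∑ w, ∑ w', ‖∑ u, (starRingEnd ℂ) (Mmat ψ ε a b u w) * Mmat ψ ε a b u w'‖ ^ 2 ≤
      Toff (Mmat ψ ε a b) + (n : ℝ) ^ 3 * (d : ℝ) ^ 4 := by
  set r : W → W → ℝ := fun w w' =>
    ‖∑ u, (starRingEnd ℂ) (Mmat ψ ε a b u w) * Mmat ψ ε a b u w'‖ ^ 2 with hr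
  have hM : ∀ u w, ‖Mmat ψ ε a b u w‖ ≤ d := by
    intro u w
    refine (norm_sum_le _ _).trans ?_
    simp
  have hdiag : ∀ w, r w w ≤ (n : ℝ) ^ 2 * (d : ℝ) ^ 4 := by
    intro w
    have : ‖∑ u, (starRingEnd ℂ) (Mmat ψ ε a b u w) * Mmat ψ ε a b u w‖ ≤ n * (d * d : ℝ) := by
      refine (norm_sum_le _ _).trans ?_
      calc _ ≤ ∑ u : U, (d * d : ℝ) := by
            refine Finset.sum_le_sum fun u _ => ?_
            rw [norm_mul, RCLike.norm_conj]
            exact mul_le_mul (hM u w) (hM u w) (norm_nonneg _) (by positivity)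
        _ = _ := by simp [hU]
    calc r w w ≤ (n * (d * d : ℝ)) ^ 2 := by
          simp only [hr]; gcongr
      _ = _ := by ring
  have hsplit : ∑ w, ∑ w', r w w' = ∑ p : W × W, (if p.1 ≠ p.2 then r p.1 p.2 else 0)
      + ∑ w, r w w := by
    rw [Fintype.sum_prod_type, ← Finset.sum_add_distrib]
    refine Finset.sum_congr rfl fun w _ => ?_
    have : r w w = ∑ w', if w = w' then r w w' else 0 := by simp
    rw [this, ← Finset.sum_add_distrib]
    refine Finset.sum_congr rfl fun w' _ => ?_
    by_cases h : w = w' <;> simp [h]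
  have hoff : Toff (Mmat ψ ε a b) = ∑ p : W × W, (if p.1 ≠ p.2 then r p.1 p.2 else 0) := by
    rw [← Finset.sum_filter]
    unfold Toff
    exact (Finset.sum_subtype _ (by simp) (fun p : W × W => r p.1 p.2)).symm
  show ∑ w, ∑ w', r w w' ≤ _
  rw [hsplit, hoff]
  gcongr
  calc ∑ w, r w w ≤ ∑ w : W, (n : ℝ) ^ 2 * (d : ℝ) ^ 4 := Finset.sum_le_sum fun w _ => hdiag w
    _ = _ := by simp [hW]; ring

lemma numeric (n k d : ℕ) (hn : 1 ≤ n) (hk : 1 ≤ k) (hd : 1 ≤ d) (η p Y : ℝ) (hη : 0 < η)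
    (hY : Y * (η ^ 4 * n) = 128 * (k : ℝ) ^ 4)
    (hp : p * ((η * (n * d : ℝ)) ^ 4 / 2) ^ k ≤
      (n : ℝ) ^ k * (k : ℝ) ^ (2 * k) * ((n : ℝ) ^ 2 * (d : ℝ) ^ 4) ^ k
        + 1 / (2 * n : ℝ) ^ (2 * k + 1) * ((n : ℝ) * d) ^ (4 * k)) :
    p ≤ Y ^ k := by
  have hn' : (1 : ℝ) ≤ n := by exact_mod_cast hn
  have hk' : (1 : ℝ) ≤ k := by exact_mod_cast hk
  have hd' : (1 : ℝ) ≤ d := by exact_mod_cast hd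
  set R : ℝ := (n : ℝ) ^ 3 * (d : ℝ) ^ 4 with hR
  have hR0 : 0 < R := by positivity
  have h1 : Y ^ k * ((η * (n * d : ℝ)) ^ 4 / 2) ^ k = R ^ k * (64 * (k : ℝ) ^ 4) ^ k := by
    rw [← mul_pow, ← mul_pow]
    congr 1
    have : Y * ((η * (n * d : ℝ)) ^ 4 / 2) = (Y * (η ^ 4 * n)) * R / 2 := by rw [hR]; ring
    rw [this, hY]; ring
  have h2 : (n : ℝ) ^ k * (k : ℝ) ^ (2 * k) * ((n : ℝ) ^ 2 * (d : ℝ) ^ 4) ^ k =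
      R ^ k * ((k : ℝ) ^ 2) ^ k := by
    rw [pow_mul, ← mul_pow, ← mul_pow, ← mul_pow]
    congr 1
    rw [hR]; ring
  have h3 : 1 / (2 * n : ℝ) ^ (2 * k + 1) * ((n : ℝ) * d) ^ (4 * k) ≤ R ^ k := by
    have e : ((n : ℝ) * d) ^ (4 * k) = R ^ k * (n : ℝ) ^ k := by
      rw [pow_mul, ← mul_pow]; congr 1; rw [hR]; ring
    rw [e, one_div, inv_mul_le_iff₀ (by positivity), mul_comm]
    gcongr
    calc (n : ℝ) ^ k ≤ (2 * n : ℝ) ^ k := by gcongr; linarith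
      _ ≤ (2 * n : ℝ) ^ (2 * k + 1) := by
        apply pow_le_pow_right₀ <;> first | linarith | omega
  have h4 : ((k : ℝ) ^ 2) ^ k + 1 ≤ (64 * (k : ℝ) ^ 4) ^ k := by
    have a1 : (1 : ℝ) ≤ ((k : ℝ) ^ 4) ^ k := one_le_pow₀ (one_le_pow₀ hk')
    have a2 : ((k : ℝ) ^ 2) ^ k ≤ ((k : ℝ) ^ 4) ^ k := by
      gcongr <;> first | exact hk' | norm_num
    have a3 : (2 : ℝ) ≤ 64 ^ k := by
      calc (2 : ℝ) ≤ 64 ^ 1 := by norm_num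
        _ ≤ 64 ^ k := pow_le_pow_right₀ (by norm_num) hk
    rw [mul_pow]
    nlinarith
  have h5 : p * ((η * (n * d : ℝ)) ^ 4 / 2) ^ k ≤ Y ^ k * ((η * (n * d : ℝ)) ^ 4 / 2) ^ k := by
    rw [h1]
    calc _ ≤ _ := hp
      _ ≤ R ^ k * ((k : ℝ) ^ 2) ^ k + R ^ k := by rw [h2]; gcongr
      _ = R ^ k * (((k : ℝ) ^ 2) ^ k + 1) := by ring
      _ ≤ _ := by gcongr
  exact le_of_mul_le_mul_right h5 (by positivity)

/-- expansion of the lifted graph, Theorem 4.2.  Let Γ be the Δ-regular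
complete balanced bipartite multigraph with parts of size n and edge set E ⊆ F with
|E| = nΔ, where n ∣ Δ, n ≤ Δ and Δ·n ≤ q = |F|.  Let D be a probability distribution on
(F^t)^V of bias at most β = 1/|V|^{2k+1}.  Then for every η ∈ (0,1), the probability over
L ∼ D that the lifted graph Γ̄ has λ₂(Γ̄) ≥ ηΔ is strictly less than
q^t · (4k/(η·|V|^{1/4}))^{2k}. -/
theorem stmt9 (F : Type) [Field F] [Fintype F] [DecidableEq F]
    (t n k Δ : ℕ) (ht : 1 ≤ t) (hn : 1 ≤ n) (hk : 1 ≤ k)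
    (hdvd : n ∣ Δ) (hnΔ : n ≤ Δ) (hΔq : Δ * n ≤ Fintype.card F)
    {V : Type} [Fintype V] [DecidableEq V]
    (V0 V1 : Finset V) (hdisj : Disjoint V0 V1) (hcover : V0 ∪ V1 = Finset.univ)
    (hV0 : V0.card = n) (hV1 : V1.card = n)
    (E : Finset F) (hE : E.card = n * Δ)
    (v0 v1 : ↥E → V) (hb0 : ∀ e, v0 e ∈ V0) (hb1 : ∀ e, v1 e ∈ V1)
    (hcomplete : ∀ u ∈ V0, ∀ w ∈ V1, Nat.card {e : ↥E // v0 e = u ∧ v1 e = w} = Δ / n)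
    (D : (V → Fin t → F) → ℝ) (hD0 : ∀ L, 0 ≤ D L) (hD1 : ∑ L, D L = 1)
    (hbias : ∀ χ : AddChar (V → Fin t → F) ℂ, (∃ z, χ z ≠ 1) →
      ‖∑ L, (D L : ℂ) * χ L‖ ≤ 1 / (Fintype.card V : ℝ) ^ (2 * k + 1))
    (η : ℝ) (hη0 : 0 < η) (hη1 : η < 1) :
    ∑ L ∈ Finset.univ.filter (fun L : V → Fin t → F =>
        η * (Δ : ℝ) ≤ lambda2Lifted F t E v0 v1 L), D L
      < (Fintype.card F : ℝ) ^ t *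
          (4 * (k : ℝ) / (η * (Fintype.card V : ℝ) ^ ((1 : ℝ) / 4))) ^ (2 * k) := by
  obtain ⟨d, rfl⟩ := hdvd
  have hnpos : 0 < n := hn
  have hd1 : 1 ≤ d := by
    rcases Nat.eq_zero_or_pos d with h | h
    · subst h; omega
    · exact h
  have hcardV : Fintype.card V = 2 * n := by
    rw [← Finset.card_univ, ← hcover, Finset.card_union_of_disjoint hdisj]
    omega
  rw [Nat.mul_div_cancel_left d hnpos] at hcomplete
  obtain ⟨ee, hee, he0, he1⟩ := exists_edges V0 V1 E v0 v1 hb0 hb1 hcomplete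
  have hne : ∀ e, v0 e ≠ v1 e := fun e h =>
    Finset.disjoint_left.1 hdisj (hb0 e) (h ▸ hb1 e)
  have hn' : (1 : ℝ) ≤ n := by exact_mod_cast hn
  have hk' : (1 : ℝ) ≤ k := by exact_mod_cast hk
  have hd' : (1 : ℝ) ≤ d := by exact_mod_cast hd1
  have hcV : (Fintype.card V : ℝ) = 2 * n := by rw [hcardV]; push_cast; ring
  rw [hcV] at hbias ⊢
  set X : ℝ := 4 * (k : ℝ) / (η * (2 * n : ℝ) ^ ((1 : ℝ) / 4)) with hX
  have hXpos : 0 < X := by positivity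
  have hq : (1 : ℝ) < (Fintype.card F : ℝ) ^ t := by
    have : 1 < Fintype.card F := Fintype.one_lt_card
    exact one_lt_pow₀ (by exact_mod_cast this) (by omega)
  rcases le_or_gt 1 X with hX1 | hX1
  · calc _ ≤ ∑ L, D L := Finset.sum_le_sum_of_subset_of_nonneg (Finset.filter_subset _ _)
          (fun L _ _ => hD0 L)
      _ = 1 := hD1
      _ < (Fintype.card F : ℝ) ^ t * 1 := by linarith
      _ ≤ _ := by
        gcongr
        exact one_le_pow₀ hX1
  set μ : ℝ := η * ((n * d : ℕ) : ℝ) with hμ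
  have hμ' : μ = η * (n * d : ℝ) := by rw [hμ]; push_cast; rfl
  have hμ0 : 0 < μ := by rw [hμ']; positivity
  have hY : X ^ 4 * (η ^ 4 * n) = 128 * (k : ℝ) ^ 4 := by
    have : ((2 * n : ℝ) ^ ((1 : ℝ) / 4)) ^ 4 = 2 * n := by
      rw [← Real.rpow_natCast, ← Real.rpow_mul (by positivity)]
      norm_num
    rw [hX, div_pow, mul_pow, mul_pow, this]
    field_simp
    norm_num
  have hX4 : X ^ 4 < 1 := pow_lt_one₀ hXpos.le hX1 (by norm_num)
  have hsmall : (n : ℝ) ^ 3 * (d : ℝ) ^ 4 ≤ μ ^ 4 / 2 := by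
    have h1 : 2 ≤ η ^ 4 * n := by
      have a : (1 : ℝ) ≤ (k : ℝ) ^ 4 := one_le_pow₀ hk'
      have b : 0 < η ^ 4 * n := by positivity
      nlinarith
    have h2 : μ ^ 4 / 2 = (η ^ 4 * n) * ((n : ℝ) ^ 3 * (d : ℝ) ^ 4) / 2 := by rw [hμ']; ring
    rw [h2]
    have h3 : 0 < (n : ℝ) ^ 3 * (d : ℝ) ^ 4 := by positivity
    nlinarith
  have hU : Fintype.card ↥V0 = n := by rw [Fintype.card_coe, hV0]
  have hW : Fintype.card ↥V1 = n := by rw [Fintype.card_coe, hV1]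
  set T : AddChar (Fin t → F) ℂ → (V → Fin t → F) → ℝ := fun ψ L =>
    Toff (Mmat ψ (fun u w j => (ee u w j : F)) (fun u : ↥V0 => L u) (fun w : ↥V1 => L w)) with hT
  have hT0 : ∀ ψ L, 0 ≤ T ψ L := fun ψ L => by
    simp only [hT, Toff]; positivity
  have hprob : ∀ ψ : AddChar (Fin t → F) ℂ, ψ ≠ 0 →
      ∑ L ∈ Finset.univ.filter (fun L => μ ^ 4 / 2 ≤ T ψ L), D L ≤ X ^ (2 * k) := by
    intro ψ hψ
    have hψ' : ∃ z, ψ z ≠ 1 := by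
      by_contra hc
      push Not at hc
      exact hψ (by ext z; simp [hc z])
    have hm := momentD (d := d) (k := k) (n := n) hk ψ hψ' (fun u w j => (ee u w j : F))
      (by
        intro u w w' j j' h
        have h' : ee u w j = ee u w' j' := Subtype.ext h
        have : (w : V) = w' := by rw [← he1 u w j, ← he1 u w' j', h']
        exact Subtype.ext this)
      (fun u : ↥V0 => (u : V)) (fun w : ↥V1 => (w : V)) Subtype.val_injective
      (fun u w h => Finset.disjoint_left.1 hdisj u.2 (h ▸ w.2)) hU hW D hD0 hD1
      (1 / (2 * n : ℝ) ^ (2 * k + 1)) (by positivity) hbias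
    have hmark : (∑ L ∈ Finset.univ.filter (fun L => μ ^ 4 / 2 ≤ T ψ L), D L) *
        (μ ^ 4 / 2) ^ k ≤ ∑ L, D L * T ψ L ^ k := by
      rw [Finset.sum_mul]
      calc _ ≤ ∑ L ∈ Finset.univ.filter (fun L => μ ^ 4 / 2 ≤ T ψ L), D L * T ψ L ^ k := by
            refine Finset.sum_le_sum fun L hL => ?_
            have := (Finset.mem_filter.1 hL).2
            have := hD0 L
            gcongr
        _ ≤ _ := Finset.sum_le_sum_of_subset_of_nonneg (Finset.filter_subset _ _)
            (fun L _ _ => mul_nonneg (hD0 L) (pow_nonneg (hT0 ψ L) k))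
    have hfin := hmark.trans hm
    rw [hμ'] at hfin
    have := numeric n k d hn hk hd1 η _ (X ^ 4) hη0 hY hfin
    rw [← hμ'] at this
    refine this.trans ?_
    rw [← pow_mul]
    exact pow_le_pow_of_le_one hXpos.le hX1.le (by omega)
  have hunion : ∑ L ∈ Finset.univ.filter (fun L : V → Fin t → F =>
        μ ≤ lambda2Lifted F t E v0 v1 L), D L ≤
      ∑ ψ ∈ Finset.univ.erase (0 : AddChar (Fin t → F) ℂ),
        ∑ L ∈ Finset.univ.filter (fun L => μ ^ 4 / 2 ≤ T ψ L), D L := by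
    simp only [Finset.sum_filter]
    rw [Finset.sum_comm]
    refine Finset.sum_le_sum fun L _ => ?_
    have hnn : ∀ ψ ∈ Finset.univ.erase (0 : AddChar (Fin t → F) ℂ),
        0 ≤ if μ ^ 4 / 2 ≤ T ψ L then D L else 0 := by
      intro ψ _
      split_ifs
      · exact hD0 L
      · exact le_rfl
    split_ifs with hL
    · obtain ⟨ψ, hψ, hle⟩ := liftH F t V0 V1 hdisj hcover (by omega) E v0 v1 hne ee hee he0 he1 L μ
        hμ0 hL
      have hb := hle.trans (Tdiag_bound hU hW ψ (fun u w j => (ee u w j : F))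
        (fun u : ↥V0 => L u) (fun w : ↥V1 => L w))
      have hTT : μ ^ 4 / 2 ≤ T ψ L := by
        simp only [hT]
        linarith
      refine le_trans (le_of_eq ?_) (Finset.single_le_sum hnn
        (Finset.mem_erase.2 ⟨hψ, Finset.mem_univ ψ⟩))
      rw [if_pos hTT]
    · exact Finset.sum_nonneg hnn
  refine lt_of_le_of_lt (hunion.trans (Finset.sum_le_sum fun ψ hψ =>
    hprob ψ (Finset.mem_erase.1 hψ).1)) ?_
  rw [Finset.sum_const, nsmul_eq_mul]
  have hXp : 0 < X ^ (2 * k) := by positivity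
  refine mul_lt_mul_of_pos_right ?_ hXp
  have hc : (Finset.univ.erase (0 : AddChar (Fin t → F) ℂ)).card < Fintype.card F ^ t := by
    have h1 : (Finset.univ.erase (0 : AddChar (Fin t → F) ℂ)).card <
        (Finset.univ : Finset (AddChar (Fin t → F) ℂ)).card :=
      Finset.card_erase_lt_of_mem (Finset.mem_univ _)
    rw [Finset.card_univ, AddChar.card_eq] at h1
    simpa using h1
  exact_mod_cast hc
end

section
/- For every ν ∈ (0,1/2), δ ∈ (ν, 1−ν], and η ∈ (0,1), there exist τ ∈ (0, ν/32) and q₀ ∈ ℕ such that the following holds for every prime power q ≥ q₀. Let Δ = ⌊q^ν⌋·⌊q^{δ−ν}⌋ and let Γ = (V = V₀ ⊔ V₁, E ⊆ F_q, v₀, v₁) be any Δ-regular complete balanced bipartite multigraph with |V₀| = |V₁| = ⌊q^ν⌋. Then there exist an integer t with q^τ < t < q^{ν/32} and a labeling L_V : V → F_q^t such that the lifted graph Γ̄ built from Γ and L_V satisfies λ₂(Γ̄) ≤ ηΔ. -/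
open scoped BigOperators


lemma eigenvalues_inst {W : Type} (A : Matrix W W ℝ) (f1 f2 : Fintype W)
    (d1 d2 : DecidableEq W) (h1 h2 : A.IsHermitian) :
    @Matrix.IsHermitian.eigenvalues ℝ _ W f1 A d1 h1 =
      @Matrix.IsHermitian.eigenvalues ℝ _ W f2 A d2 h2 := by
  obtain rfl : f1 = f2 := Subsingleton.elim _ _
  obtain rfl : d1 = d2 := Subsingleton.elim _ _
  rfl

lemma secondEig_le {W : Type} [Fintype W] (A : Matrix W W ℝ)
    (hsymm : ∀ u w, A u w = A w u) (c : ℝ) (hcard : 2 ≤ Nat.card W)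
    (h : ∀ x : W → ℝ, ∑ w, x w = 0 → ∑ u, ∑ w, x u * A u w * x w ≤ c * ∑ w, x w ^ 2) :
    secondEig A hsymm ≤ c := by
  classical
  have hA : A.IsHermitian := by
    refine Matrix.ext fun u w => ?_
    simpa [Matrix.conjTranspose_apply] using hsymm w u
  have key : secondEig A hsymm =
      ((Finset.univ.val.map hA.eigenvalues).sort (· ≤ ·)).getD
        (((Finset.univ.val.map hA.eigenvalues).sort (· ≤ ·)).length - 2) 0 := by
    unfold secondEig
    simp only
    congr! <;> exact eigenvalues_inst _ _ _ _ _ _ _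
  rw [key]
  set l := (Finset.univ.val.map hA.eigenvalues).sort (· ≤ ·) with hl
  have hlen : l.length = Fintype.card W := by simp [hl]
  rw [Nat.card_eq_fintype_card] at hcard
  by_contra! hc
  have hs : l.Pairwise (· ≤ ·) := Multiset.pairwise_sort _ _
  have h2 : 2 ≤ l.countP (fun a => decide (c < a)) := by
    have h1 : l = l.take (l.length - 2) ++ l.drop (l.length - 2) := (List.take_append_drop _ _).symm
    have hd : l.drop (l.length - 2) = [l[l.length - 2]'(by omega), l[l.length - 1]'(by omega)] := by
      rw [List.drop_eq_getElem_cons (by omega), List.drop_eq_getElem_cons (by omega)]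
      rw [List.drop_eq_nil_of_le (by omega)]
      congr 3
      omega
    rw [List.getD_eq_getElem _ _ (by omega)] at hc
    have hle : l[l.length - 2]'(by omega) ≤ l[l.length - 1]'(by omega) :=
      List.pairwise_iff_getElem.mp hs _ _ _ _ (by omega)
    rw [h1, List.countP_append, hd]
    have : c < l[l.length - 1]'(by omega) := lt_of_lt_of_le hc hle
    simp [hc, this]
  have h3 : l.countP (fun a => decide (c < a)) =
      (Finset.univ.filter fun i => c < hA.eigenvalues i).card := by
    have : (l : Multiset ℝ) = Finset.univ.val.map hA.eigenvalues := Multiset.sort_eq _ _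
    have h4 := Multiset.coe_countP (fun a => c < a) l
    rw [← h4, this, Multiset.countP_map]
    rfl
  rw [h3] at h2
  obtain ⟨i, hi, j, hj, hij⟩ := Finset.one_lt_card.mp h2
  simp only [Finset.mem_filter, Finset.mem_univ, true_and] at hi hj
  set b := hA.eigenvectorBasis with hb
  set si := ∑ w, b i w with hsi
  set sj := ∑ w, b j w with hsj
  have orth : ∀ p r, ∑ w, b p w * b r w = if p = r then 1 else 0 := by
    intro p r
    have := orthonormal_iff_ite.mp b.orthonormal r p
    rw [PiLp.inner_apply] at this
    simp only [RCLike.inner_apply, conj_trivial] at this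
    rw [this]; simp [eq_comm]
  have eig : ∀ p u, ∑ w, A u w * b p w = hA.eigenvalues p * b p u := by
    intro p u
    have := congrFun (hA.mulVec_eigenvectorBasis p) u
    simpa [Matrix.mulVec, dotProduct] using this
  have main : ∀ α β : ℝ, α * si + β * sj = 0 →
      α ^ 2 * hA.eigenvalues i + β ^ 2 * hA.eigenvalues j ≤ c * (α ^ 2 + β ^ 2) := by
    intro α β h0
    have := h (fun w => α * b i w + β * b j w) (by
      rw [Finset.sum_add_distrib, ← Finset.mul_sum, ← Finset.mul_sum]; exact h0)
    have e1 : ∑ u, ∑ w, (α * b i u + β * b j u) * A u w * (α * b i w + β * b j w)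
        = α ^ 2 * hA.eigenvalues i + β ^ 2 * hA.eigenvalues j := by
      calc _ = ∑ u, (α * b i u + β * b j u) *
          (α * (hA.eigenvalues i * b i u) + β * (hA.eigenvalues j * b j u)) := by
            refine Finset.sum_congr rfl fun u _ => ?_
            rw [← eig, ← eig, Finset.mul_sum, Finset.mul_sum, ← Finset.sum_add_distrib,
              Finset.mul_sum]
            exact Finset.sum_congr rfl fun w _ => by ring
        _ = α ^ 2 * hA.eigenvalues i * ∑ u, b i u * b i u
            + β ^ 2 * hA.eigenvalues j * ∑ u, b j u * b j u
            + (α * β * (hA.eigenvalues i + hA.eigenvalues j)) * ∑ u, b i u * b j u := by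
            simp only [Finset.mul_sum, ← Finset.sum_add_distrib]
            exact Finset.sum_congr rfl fun w _ => by ring
        _ = _ := by rw [orth, orth, orth]; simp [hij]
    have e2 : ∑ w, (α * b i w + β * b j w) ^ 2 = α ^ 2 + β ^ 2 := by
      calc _ = α ^ 2 * ∑ u, b i u * b i u
            + β ^ 2 * ∑ u, b j u * b j u
            + (2 * α * β) * ∑ u, b i u * b j u := by
            simp only [Finset.mul_sum, ← Finset.sum_add_distrib]
            exact Finset.sum_congr rfl fun w _ => by ring
        _ = _ := by rw [orth, orth, orth]; simp [hij]
    rw [e1, e2] at this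
    exact this
  by_cases hz : si = 0
  · have := main 1 0 (by simp [hz])
    norm_num at this
    linarith
  · have := main sj (-si) (by ring)
    have hp : 0 < si ^ 2 := by positivity
    nlinarith [sq_nonneg sj]

lemma quad_adjMat {W ε : Type} [Fintype W] [Fintype ε] (v0 v1 : ε → W)
    (hne : ∀ e, v0 e ≠ v1 e) (x : W → ℝ) :
    ∑ u, ∑ w, x u * adjMat v0 v1 u w * x w = 2 * ∑ e, x (v0 e) * x (v1 e) := by
  classical
  have hadj : ∀ u w, adjMat v0 v1 u w =
      ∑ e, ((if v0 e = u then 1 else 0) * (if v1 e = w then 1 else 0)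
        + (if v1 e = u then 1 else 0) * (if v0 e = w then (1 : ℝ) else 0)) := by
    intro u w
    unfold adjMat
    rw [Nat.card_eq_fintype_card, Fintype.card_subtype, Finset.card_filter]
    push_cast
    refine Finset.sum_congr rfl fun e _ => ?_
    have := hne e
    by_cases h1 : v0 e = u <;> by_cases h2 : v1 e = w <;> by_cases h3 : v1 e = u <;>
      by_cases h4 : v0 e = w <;> simp [h1, h2, h3, h4] <;> grind
  simp only [hadj, Finset.mul_sum, Finset.sum_mul]
  calc _ = ∑ u, ∑ e, ∑ w, x u * ((if v0 e = u then 1 else 0) * (if v1 e = w then 1 else 0)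
        + (if v1 e = u then 1 else 0) * (if v0 e = w then (1 : ℝ) else 0)) * x w :=
        Finset.sum_congr rfl fun u _ => Finset.sum_comm
    _ = ∑ e, ∑ u, ∑ w, x u * ((if v0 e = u then 1 else 0) * (if v1 e = w then 1 else 0)
        + (if v1 e = u then 1 else 0) * (if v0 e = w then (1 : ℝ) else 0)) * x w :=
        Finset.sum_comm
    _ = _ := by
      refine Finset.sum_congr rfl fun e _ => ?_
      simp only [mul_add, add_mul, Finset.sum_add_distrib]
      simp
      ring

/-- exponential-moment choice of labels -/
lemma exists_labels {I G Ψ : Type} [Fintype I] [Fintype G] [Nonempty G] [DecidableEq I]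
    (S : Finset Ψ) (m : ℝ) (hm : 1 ≤ m) (Y : Ψ → I → G → ℝ)
    (h0 : ∀ ψ i g, 0 ≤ Y ψ i g) (h1 : ∀ ψ i g, Y ψ i g ≤ 1)
    (hs : ∀ ψ ∈ S, ∀ i, ∑ g, Y ψ i g ≤ Fintype.card G / m) :
    ∃ L : I → G, ∀ ψ ∈ S, m ^ (∑ i, Y ψ i (L i)) ≤ S.card * 2 ^ Fintype.card I := by
  have hG : (0 : ℝ) < Fintype.card G := by exact_mod_cast Fintype.card_pos
  have hm0 : 0 < m := by linarith
  have hone : ∀ ψ ∈ S, ∀ i, ∑ g, m ^ (Y ψ i g) ≤ 2 * Fintype.card G := by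
    intro ψ hψ i
    calc ∑ g, m ^ (Y ψ i g) ≤ ∑ g, (1 + Y ψ i g * (m - 1)) := by
          refine Finset.sum_le_sum fun g _ => ?_
          have := rpow_one_add_le_one_add_mul_self (s := m - 1) (by linarith)
            (h0 ψ i g) (h1 ψ i g)
          simpa using this
      _ = Fintype.card G + (∑ g, Y ψ i g) * (m - 1) := by
          rw [Finset.sum_add_distrib, Finset.sum_mul]; simp
      _ ≤ Fintype.card G + (Fintype.card G / m) * (m - 1) := by
          have hs1 := hs ψ hψ i
          have hm1 : 0 ≤ m - 1 := by linarith
          gcongr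
      _ ≤ _ := by
          have : (Fintype.card G / m) * (m - 1) = Fintype.card G - Fintype.card G / m := by
            field_simp
          rw [this]
          have : 0 < Fintype.card G / m := by positivity
          linarith
  have hsum : ∑ L : I → G, ∑ ψ ∈ S, m ^ (∑ i, Y ψ i (L i)) ≤
      ∑ L : I → G, (S.card * 2 ^ Fintype.card I : ℝ) := by
    rw [Finset.sum_comm]
    calc ∑ ψ ∈ S, ∑ L : I → G, m ^ (∑ i, Y ψ i (L i))
        = ∑ ψ ∈ S, ∏ i, ∑ g, m ^ (Y ψ i g) := by
          refine Finset.sum_congr rfl fun ψ _ => ?_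
          rw [Fintype.prod_sum]
          exact Finset.sum_congr rfl fun L _ => Real.rpow_sum_of_pos hm0 _ _
      _ ≤ ∑ ψ ∈ S, ∏ i : I, (2 * Fintype.card G : ℝ) := by
          refine Finset.sum_le_sum fun ψ hψ => ?_
          exact Finset.prod_le_prod (fun i _ => Finset.sum_nonneg fun g _ => by positivity)
            (fun i _ => hone ψ hψ i)
      _ = _ := by
          simp [mul_pow]; ring
  obtain ⟨L, -, hL⟩ := Finset.exists_le_of_sum_le Finset.univ_nonempty hsum
  refine ⟨L, fun ψ hψ => le_trans ?_ hL⟩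
  exact Finset.single_le_sum (f := fun ψ => m ^ (∑ i, Y ψ i (L i)))
    (fun _ _ => by positivity) hψ

lemma parseval_shift {G : Type} [AddCommGroup G] [Fintype G] (f g : G → ℝ) (a : G) :
    ∑ ψ : AddChar G ℂ, ψ a * (∑ y, (f y : ℂ) * ψ y) * (starRingEnd ℂ) (∑ z, (g z : ℂ) * ψ z) =
      (Fintype.card G : ℂ) * ((∑ z, f (z - a) * g z : ℝ) : ℂ) := by
  classical
  calc _ = ∑ ψ : AddChar G ℂ, ∑ z, ∑ y, (f y : ℂ) * g z * ψ (a + y - z) := by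
        refine Finset.sum_congr rfl fun ψ _ => ?_
        rw [map_sum, Finset.mul_sum]
        refine Finset.sum_congr rfl fun z _ => ?_
        rw [Finset.mul_sum, Finset.sum_mul]
        refine Finset.sum_congr rfl fun y _ => ?_
        rw [sub_eq_add_neg, AddChar.map_add_eq_mul, AddChar.map_add_eq_mul,
          AddChar.map_neg_eq_conj, map_mul, Complex.conj_ofReal]
        ring
    _ = ∑ z, ∑ y, ∑ ψ : AddChar G ℂ, (f y : ℂ) * g z * ψ (a + y - z) := by
        rw [Finset.sum_comm]
        refine Finset.sum_congr rfl fun z _ => ?_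
        rw [Finset.sum_comm]
    _ = ∑ z, (Fintype.card G : ℂ) * (f (z - a) * g z) := by
        refine Finset.sum_congr rfl fun z _ => ?_
        simp only [← Finset.mul_sum, AddChar.sum_apply_eq_ite]
        rw [Finset.sum_eq_single (z - a)]
        · simp; ring
        · intro y _ hy
          rw [if_neg, mul_zero]
          intro h
          apply hy
          rw [sub_eq_zero] at h
          rw [← h]; abel
        · simp
    _ = _ := by rw [← Finset.mul_sum]; push_cast; rfl

lemma parseval_sq {G : Type} [AddCommGroup G] [Fintype G] (f : G → ℝ) :
    ∑ ψ : AddChar G ℂ, ‖∑ y, (f y : ℂ) * ψ y‖ ^ 2 = (Fintype.card G : ℝ) * ∑ z, f z ^ 2 := by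
  have h := parseval_shift f f 0
  have h2 : (∑ ψ : AddChar G ℂ, ((‖∑ y, (f y : ℂ) * ψ y‖ ^ 2 : ℝ) : ℂ)) =
      (((Fintype.card G : ℝ) * ∑ z, f z ^ 2 : ℝ) : ℂ) := by
    calc _ = _ := by
          refine Finset.sum_congr rfl fun ψ _ => ?_
          rw [AddChar.map_zero_eq_one, one_mul, Complex.mul_conj, Complex.normSq_eq_norm_sq]
      _ = _ := h
      _ = _ := by
          push_cast
          simp [sq]
  exact_mod_cast h2

lemma bilin_bound {V : Type} [Fintype V] (M : V → V → ℂ) (p : V → ℂ) (B : ℝ) (hB : 0 ≤ B)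
    (hM : ∑ u, ∑ w, ‖M u w‖ ^ 2 ≤ B ^ 2) :
    ‖∑ u, ∑ w, M u w * p u * (starRingEnd ℂ) (p w)‖ ≤ B * ∑ v, ‖p v‖ ^ 2 := by
  have h1 : ‖∑ u, ∑ w, M u w * p u * (starRingEnd ℂ) (p w)‖ ≤
      ∑ x : V × V, ‖M x.1 x.2‖ * (‖p x.1‖ * ‖p x.2‖) := by
    rw [Fintype.sum_prod_type]
    refine (norm_sum_le _ _).trans (Finset.sum_le_sum fun u _ => ?_)
    refine (norm_sum_le _ _).trans (Finset.sum_le_sum fun w _ => ?_)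
    rw [norm_mul, norm_mul, RCLike.norm_conj, mul_assoc]
  refine h1.trans ?_
  have h2 := Finset.sum_mul_sq_le_sq_mul_sq (Finset.univ : Finset (V × V))
    (fun x => ‖M x.1 x.2‖) (fun x => ‖p x.1‖ * ‖p x.2‖)
  have h3 : ∑ x : V × V, (‖p x.1‖ * ‖p x.2‖) ^ 2 = (∑ v, ‖p v‖ ^ 2) ^ 2 := by
    rw [Fintype.sum_prod_type, sq (∑ v, ‖p v‖ ^ 2), Finset.sum_mul_sum]
    simp [mul_pow]
  have hS : 0 ≤ ∑ v, ‖p v‖ ^ 2 := Finset.sum_nonneg fun _ _ => by positivity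
  rw [h3, Fintype.sum_prod_type (fun x : V × V => ‖M x.1 x.2‖ ^ 2)] at h2
  refine abs_le_of_sq_le_sq' (h2.trans ?_) (by positivity) |>.2
  rw [mul_pow]
  gcongr

lemma fourier_bound {V ε G : Type} [Fintype V] [DecidableEq V] [Fintype ε]
    [AddCommGroup G] [Fintype G]
    (v0 v1 : ε → V) (a : ε → G) (X : V → G → ℝ) (B : ℝ) (hB : 0 ≤ B)
    (hM : ∀ ψ : AddChar G ℂ, ψ ≠ 0 →
      ∑ u, ∑ w, ‖∑ e with v0 e = u ∧ v1 e = w, ψ (a e)‖ ^ 2 ≤ B ^ 2)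
    (hz : ∑ e, (∑ y, X (v0 e) y) * (∑ y, X (v1 e) y) ≤ 0) :
    ∑ e, ∑ y, X (v0 e) (y - a e) * X (v1 e) y ≤ B * ∑ v, ∑ y, X v y ^ 2 := by
  classical
  set p : AddChar G ℂ → V → ℂ := fun ψ v => ∑ y, (X v y : ℂ) * ψ y with hp
  have hG : (0 : ℝ) < Fintype.card G := by exact_mod_cast Fintype.card_pos
  set T : AddChar G ℂ → ℂ :=
    fun ψ => ∑ e, ψ (a e) * p ψ (v0 e) * (starRingEnd ℂ) (p ψ (v1 e)) with hT
  have h1 : ∑ ψ, T ψ = (((Fintype.card G : ℝ) *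
      ∑ e, ∑ y, X (v0 e) (y - a e) * X (v1 e) y : ℝ) : ℂ) := by
    rw [hT, Finset.sum_comm, Finset.mul_sum]
    push_cast
    refine Finset.sum_congr rfl fun e _ => ?_
    have := parseval_shift (X (v0 e)) (X (v1 e)) (a e)
    push_cast at this
    exact this
  have hre : ∀ ψ, (T ψ).re ≤ B * ∑ v, ‖p ψ v‖ ^ 2 := by
    intro ψ
    by_cases h0 : ψ = 0
    · subst h0
      have : T 0 = ((∑ e, (∑ y, X (v0 e) y) * (∑ y, X (v1 e) y) : ℝ) : ℂ) := by
        simp [hT, hp]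
      rw [this, Complex.ofReal_re]
      exact hz.trans (mul_nonneg hB (Finset.sum_nonneg fun _ _ => by positivity))
    · have e1 : T ψ = ∑ u, ∑ w, (∑ e with v0 e = u ∧ v1 e = w, ψ (a e)) * p ψ u *
          (starRingEnd ℂ) (p ψ w) := by
        rw [hT]
        simp only
        rw [← Finset.sum_fiberwise (s := Finset.univ) (g := v0)]
        refine Finset.sum_congr rfl fun u _ => ?_
        rw [← Finset.sum_fiberwise (g := v1)]
        refine Finset.sum_congr rfl fun w _ => ?_
        rw [Finset.sum_mul, Finset.sum_mul, Finset.filter_filter]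
        refine Finset.sum_congr rfl fun e he => ?_
        simp only [Finset.mem_filter, Finset.mem_univ, true_and] at he
        rw [he.1, he.2]
      rw [e1]
      exact (Complex.re_le_norm _).trans (bilin_bound _ _ B hB (hM ψ h0))
  have h2 : (∑ ψ, T ψ).re ≤ ∑ ψ : AddChar G ℂ, B * ∑ v, ‖p ψ v‖ ^ 2 := by
    rw [Complex.re_sum]
    exact Finset.sum_le_sum fun ψ _ => hre ψ
  rw [h1, Complex.ofReal_re, ← Finset.mul_sum,
    Finset.sum_comm (f := fun ψ v => ‖p ψ v‖ ^ 2)] at h2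
  simp only [hp, parseval_sq] at h2
  rw [← Finset.mul_sum] at h2
  nlinarith

lemma charsum_sq {F G : Type} [Field F] [AddCommGroup G] [Module F G] [Fintype G]
    (ψ : AddChar G ℂ) (hψ : ψ ≠ 0) {ε : Type} (s : Finset ε) (c : ε → F)
    (hc : Function.Injective c) :
    ∑ g : G, ‖∑ e ∈ s, ψ (c e • g)‖ ^ 2 = (Fintype.card G : ℝ) * s.card := by
  classical
  have key : ((∑ g : G, ‖∑ e ∈ s, ψ (c e • g)‖ ^ 2 : ℝ) : ℂ) =
      (((Fintype.card G : ℝ) * s.card : ℝ) : ℂ) := by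
    push_cast
    calc _ = ∑ g : G, ∑ e ∈ s, ∑ e' ∈ s, ψ ((c e - c e') • g) := by
          refine Finset.sum_congr rfl fun g _ => ?_
          rw [← Complex.mul_conj', map_sum, Finset.sum_mul_sum]
          refine Finset.sum_congr rfl fun e _ => Finset.sum_congr rfl fun e' _ => ?_
          rw [sub_smul, sub_eq_add_neg, AddChar.map_add_eq_mul, AddChar.map_neg_eq_conj]
      _ = ∑ e ∈ s, ∑ e' ∈ s, ∑ g : G, ψ ((c e - c e') • g) := by
          rw [Finset.sum_comm]
          exact Finset.sum_congr rfl fun e _ => Finset.sum_comm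
      _ = ∑ e ∈ s, ∑ e' ∈ s, if e = e' then (Fintype.card G : ℂ) else 0 := by
          refine Finset.sum_congr rfl fun e _ => Finset.sum_congr rfl fun e' _ => ?_
          split_ifs with h
          · subst h; simp
          · have hne : c e - c e' ≠ 0 := sub_ne_zero.mpr fun hh => h (hc hh)
            have := Equiv.sum_comp (MulAction.toPerm (Units.mk0 _ hne) : Equiv.Perm G)
              (fun g => ψ g)
            rw [AddChar.sum_eq_ite, if_neg hψ] at this
            exact this
      _ = _ := by simp [mul_comm]
  exact_mod_cast key

lemma zero_term {V ε : Type} [Fintype V] [DecidableEq V] [Fintype ε] (V0 V1 : Finset V)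
    (v0 v1 : ε → V) (hd : Disjoint V0 V1) (hu : V0 ∪ V1 = Finset.univ)
    (h0 : ∀ e, v0 e ∈ V0) (h1 : ∀ e, v1 e ∈ V1) (m : ℕ)
    (hk : ∀ u ∈ V0, ∀ w ∈ V1, Nat.card {e : ε // v0 e = u ∧ v1 e = w} = m)
    (S : V → ℝ) (hS : ∑ v, S v = 0) : ∑ e, S (v0 e) * S (v1 e) ≤ 0 := by
  classical
  have e1 : ∑ e, S (v0 e) * S (v1 e) = m * ((∑ u ∈ V0, S u) * ∑ w ∈ V1, S w) := by
    rw [Finset.sum_mul_sum, Finset.mul_sum,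
      ← Finset.sum_fiberwise_of_maps_to (s := Finset.univ) (t := V0) (g := v0) (fun e _ => h0 e)]
    refine Finset.sum_congr rfl fun u hu => ?_
    rw [Finset.mul_sum, ← Finset.sum_fiberwise_of_maps_to (t := V1) (g := v1) (fun e _ => h1 e)]
    refine Finset.sum_congr rfl fun w hw => ?_
    rw [Finset.filter_filter]
    have hc : (Finset.univ.filter fun e => v0 e = u ∧ v1 e = w).card = m := by
      rw [← hk u hu w hw, Nat.card_eq_fintype_card, Fintype.card_subtype]
    rw [Finset.sum_congr rfl (g := fun _ => S u * S w), Finset.sum_const, hc, nsmul_eq_mul]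
    intro e he
    simp only [Finset.mem_filter, Finset.mem_univ, true_and] at he
    rw [he.1, he.2]
  rw [← hu, Finset.sum_union hd] at hS
  have : ∑ w ∈ V1, S w = - ∑ u ∈ V0, S u := by linarith
  rw [e1, this]
  have hm : (0 : ℝ) ≤ m := by positivity
  nlinarith [mul_nonneg hm (sq_nonneg (∑ u ∈ V0, S u))]

/-- Coordinates on the lifted vertices. -/
def liftCoord (F : Type) [Field F] (t : ℕ) {V : Type} (L : V → Fin t → F)
    (p : V × (Fin t → F)) : LiftedVertex F t L :=
  ⟨p.1, Submodule.Quotient.mk ((0 : F), p.2)⟩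

lemma liftCoord_bijective (F : Type) [Field F] (t : ℕ) {V : Type} (L : V → Fin t → F) :
    Function.Bijective (liftCoord F t L) := by
  constructor
  · rintro ⟨v, y⟩ ⟨v', y'⟩ h
    obtain ⟨h1, h2⟩ := Sigma.mk.inj h
    simp only at h1
    subst h1
    simp only [heq_eq_eq] at h2
    rw [Submodule.Quotient.eq, Submodule.mem_span_singleton] at h2
    obtain ⟨a, ha⟩ := h2
    rw [Prod.ext_iff] at ha
    simp at ha
    obtain ⟨rfl, ha⟩ := ha
    rw [zero_smul] at ha
    rw [sub_eq_zero.mp ha.symm]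
  · rintro ⟨v, c⟩
    obtain ⟨⟨s, y⟩, rfl⟩ := Submodule.Quotient.mk_surjective _ c
    refine ⟨(v, y - s • L v), ?_⟩
    unfold liftCoord
    simp only
    congr 1
    rw [Submodule.Quotient.eq, Submodule.mem_span_singleton]
    exact ⟨-s, by ext <;> simp⟩

lemma liftedEnd_eq (F : Type) [Field F] (t : ℕ) {V : Type} (E : Finset F) (vb : ↥E → V)
    (L : V → Fin t → F) (p : ↥E × (Fin t → F)) :
    liftedEnd F t E vb L p = liftCoord F t L (vb p.1, p.2 - (p.1 : F) • L (vb p.1)) := by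
  unfold liftCoord liftedEnd
  simp only
  congr 1
  rw [Submodule.Quotient.eq, Submodule.mem_span_singleton]
  exact ⟨p.1, by ext <;> simp⟩

lemma lifted_bound (F : Type) [Field F] [Fintype F] [DecidableEq F] (t : ℕ)
    (V : Type) [Fintype V] [DecidableEq V] (V0 V1 : Finset V)
    (E : Finset F) (v0 v1 : ↥E → V) (hd : Disjoint V0 V1) (hu : V0 ∪ V1 = Finset.univ)
    (hn0 : V0.Nonempty) (hn1 : V1.Nonempty)
    (h0 : ∀ e, v0 e ∈ V0) (h1 : ∀ e, v1 e ∈ V1) (m : ℕ)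
    (hk : ∀ u ∈ V0, ∀ w ∈ V1, Nat.card {e : ↥E // v0 e = u ∧ v1 e = w} = m)
    (L : V → Fin t → F) (hL : ∀ w ∈ V1, L w = 0) (B : ℝ) (hB : 0 ≤ B)
    (hM : ∀ ψ : AddChar (Fin t → F) ℂ, ψ ≠ 0 →
      ∑ u, ∑ w, ‖∑ e : ↥E with v0 e = u ∧ v1 e = w, ψ ((e : F) • L u)‖ ^ 2 ≤ B ^ 2) :
    lambda2Lifted F t E v0 v1 L ≤ 2 * B := by
  classical
  haveI : Fintype (LiftedVertex F t L) := Fintype.ofFinite _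
  unfold lambda2Lifted graphLambda2
  let φ : V × (Fin t → F) ≃ LiftedVertex F t L := Equiv.ofBijective _ (liftCoord_bijective F t L)
  obtain ⟨u0, hu0⟩ := hn0
  obtain ⟨w0, hw0⟩ := hn1
  have huw : u0 ≠ w0 := fun h => Finset.disjoint_left.mp hd hu0 (h ▸ hw0)
  apply secondEig_le
  · rw [Nat.card_eq_fintype_card]
    refine Fintype.one_lt_card_iff.mpr ⟨φ (u0, 0), φ (w0, 0), fun h => huw ?_⟩
    exact (Prod.ext_iff.mp (φ.injective h)).1
  · intro x hx
    rw [quad_adjMat]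
    · set X : V → (Fin t → F) → ℝ := fun v y => x (φ (v, y)) with hX
      have hx0 : ∑ v, ∑ y, X v y = 0 := by
        rw [← hx, ← Equiv.sum_comp φ, Fintype.sum_prod_type]
      have hx2 : ∑ w, x w ^ 2 = ∑ v, ∑ y, X v y ^ 2 := by
        rw [← Equiv.sum_comp φ, Fintype.sum_prod_type]
      have hb := fourier_bound v0 v1 (fun e => (e : F) • L (v0 e)) X B hB (by
        intro ψ hψ
        refine le_of_eq_of_le ?_ (hM ψ hψ)
        refine Finset.sum_congr rfl fun u _ => Finset.sum_congr rfl fun w _ => ?_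
        congr 2
        refine Finset.sum_congr rfl fun e he => ?_
        simp only [Finset.mem_filter, Finset.mem_univ, true_and] at he
        rw [he.1])
        (zero_term V0 V1 v0 v1 hd hu h0 h1 m hk _ hx0)
      have hq : ∑ e : ↥E × (Fin t → F), x (liftedEnd F t E v0 L e) * x (liftedEnd F t E v1 L e)
          = ∑ e, ∑ y, X (v0 e) (y - (e : F) • L (v0 e)) * X (v1 e) y := by
        rw [Fintype.sum_prod_type]
        refine Finset.sum_congr rfl fun e _ => Finset.sum_congr rfl fun y _ => ?_
        rw [liftedEnd_eq, liftedEnd_eq]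
        simp only [hL _ (h1 e), smul_zero, sub_zero]
        rfl
      rw [hq, hx2]
      linarith
    · intro e h
      have := congrArg Sigma.fst h
      exact Finset.disjoint_left.mp hd (h0 e.1) (by
        have h2 : v0 e.1 = v1 e.1 := this
        rw [h2]; exact h1 e.1)

lemma label_exists (F : Type) [Field F] [Fintype F] [DecidableEq F] (t : ℕ)
    (V : Type) [Fintype V] [DecidableEq V] (V0 V1 : Finset V)
    (E : Finset F) (v0 v1 : ↥E → V) (hd : Disjoint V0 V1) (hu : V0 ∪ V1 = Finset.univ)
    (N m : ℕ) (hN : 1 ≤ N) (hm : 1 ≤ m) (hc0 : V0.card = N) (hc1 : V1.card = N)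
    (h0 : ∀ e, v0 e ∈ V0) (h1 : ∀ e, v1 e ∈ V1)
    (hk : ∀ u ∈ V0, ∀ w ∈ V1, Nat.card {e : ↥E // v0 e = u ∧ v1 e = w} = m)
    (η : ℝ) (hη : 0 < η) (hm2 : 12 / η ^ 2 ≤ Real.log m)
    (ht : t * Real.log (Fintype.card F) ≤ N) :
    ∃ L : V → Fin t → F, (∀ w ∈ V1, L w = 0) ∧ 
      ∀ ψ : AddChar (Fin t → F) ℂ, ψ ≠ 0 →
      ∑ u, ∑ w, ‖∑ e : ↥E with v0 e = u ∧ v1 e = w, ψ ((e : F) • L u)‖ ^ 2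
        ≤ (η * (N * m) / 2) ^ 2 := by
  classical
  have hNp : (0 : ℝ) < N := by exact_mod_cast hN
  have hmp : (0 : ℝ) < m := by exact_mod_cast hm
  have hm1 : (1 : ℝ) ≤ m := by exact_mod_cast hm
  let k : V → V → Finset ↥E := fun u w => Finset.univ.filter fun e => v0 e = u ∧ v1 e = w
  have hkc : ∀ u w, (k u w).card ≤ m := by
    intro u w
    by_cases hne : (k u w).Nonempty
    · obtain ⟨e, he⟩ := hne
      simp only [k, Finset.mem_filter, Finset.mem_univ, true_and] at he
      rw [← hk u (he.1 ▸ h0 e) w (he.2 ▸ h1 e), Nat.card_eq_fintype_card, Fintype.card_subtype]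
    · rw [Finset.not_nonempty_iff_eq_empty] at hne
      simp [hne]
  have hk0 : ∀ u w, w ∉ V1 → k u w = ∅ := by
    intro u w hw
    refine Finset.filter_eq_empty_iff.mpr fun e _ he => hw (he.2 ▸ h1 e)
  have hk1 : ∀ u w, u ∉ V0 → k u w = ∅ := by
    intro u w hw
    refine Finset.filter_eq_empty_iff.mpr fun e _ he => hw (he.1 ▸ h0 e)
  let Z : AddChar (Fin t → F) ℂ → V → (Fin t → F) → ℝ := fun ψ u g =>
    ∑ w, ‖∑ e ∈ k u w, ψ ((e : F) • g)‖ ^ 2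
  have hZ1 : ∀ ψ u g, Z ψ u g = ∑ w ∈ V1, ‖∑ e ∈ k u w, ψ ((e : F) • g)‖ ^ 2 := by
    intro ψ u g
    refine (Finset.sum_subset (Finset.subset_univ _) fun w _ hw => ?_).symm
    simp [hk0 u w hw]
  have hZ0 : ∀ ψ u g, 0 ≤ Z ψ u g := fun ψ u g => Finset.sum_nonneg fun _ _ => by positivity
  have hZle : ∀ ψ u g, Z ψ u g ≤ N * m ^ 2 := by
    intro ψ u g
    rw [hZ1]
    calc _ ≤ ∑ w ∈ V1, (m : ℝ) ^ 2 := by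
          refine Finset.sum_le_sum fun w _ => ?_
          have : ‖∑ e ∈ k u w, ψ ((e : F) • g)‖ ≤ m := by
            calc _ ≤ ∑ e ∈ k u w, ‖ψ ((e : F) • g)‖ := norm_sum_le _ _
              _ = (k u w).card := by simp
              _ ≤ m := by exact_mod_cast hkc u w
          gcongr
      _ = _ := by simp [hc1]
  have hZs : ∀ ψ, ψ ≠ 0 → ∀ u, ∑ g, Z ψ u g ≤ N * (Fintype.card (Fin t → F) * m) := by
    intro ψ hψ u
    simp only [hZ1]
    rw [Finset.sum_comm]
    calc _ ≤ ∑ w ∈ V1, (Fintype.card (Fin t → F) * m : ℝ) := by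
          refine Finset.sum_le_sum fun w _ => ?_
          rw [charsum_sq ψ hψ (k u w) (fun e : ↥E => (e : F)) Subtype.val_injective]
          have : ((k u w).card : ℝ) ≤ m := by exact_mod_cast hkc u w
          gcongr
      _ = _ := by simp [hc1]
  obtain ⟨L', hL'⟩ := exists_labels (I := V) (G := Fin t → F)
    (Finset.univ.filter fun ψ : AddChar (Fin t → F) ℂ => ψ ≠ 0) (m : ℝ) hm1
    (fun ψ u g => Z ψ u g / (N * m ^ 2))
    (fun ψ u g => div_nonneg (hZ0 ψ u g) (by positivity))
    (fun ψ u g => (div_le_one (by positivity)).mpr (hZle ψ u g))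
    (by
      intro ψ hψ u
      simp only [Finset.mem_filter, Finset.mem_univ, true_and] at hψ
      rw [← Finset.sum_div, div_le_div_iff₀ (by positivity) hmp]
      have := mul_le_mul_of_nonneg_right (hZs ψ hψ u) hmp.le
      nlinarith)
  refine ⟨fun v => if v ∈ V0 then L' v else 0, ?_, ?_⟩
  · intro w hw
    exact if_neg (Finset.disjoint_right.mp hd hw)
  intro ψ hψ
  have hb := hL' ψ (by simp [hψ])
  have hcV : Fintype.card V = N + N := by
    rw [← Finset.card_univ, ← hu, Finset.card_union_of_disjoint hd, hc0, hc1]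
  have hS : ((Finset.univ.filter fun ψ : AddChar (Fin t → F) ℂ => ψ ≠ 0).card : ℝ) ≤
      (Fintype.card F : ℝ) ^ t := by
    have : (Finset.univ.filter fun ψ : AddChar (Fin t → F) ℂ => ψ ≠ 0).card ≤
        Fintype.card F ^ t := by
      refine (Finset.card_le_univ _).trans ?_
      rw [AddChar.card_eq]; simp
    exact_mod_cast this
  have hF : (0 : ℝ) < Fintype.card F := by exact_mod_cast Fintype.card_pos
  rw [← Finset.sum_div] at hb
  set T := ∑ u, Z ψ u (L' u) with hT
  have hb2 : (m : ℝ) ^ (T / (N * m ^ 2)) ≤ (Fintype.card F : ℝ) ^ t * 2 ^ (N + N) := by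
    refine hb.trans ?_
    rw [hcV]
    gcongr
  have hlog := Real.log_le_log (by positivity) hb2
  rw [Real.log_rpow hmp, Real.log_mul (by positivity) (by positivity), Real.log_pow,
    Real.log_pow] at hlog
  have hl2 : Real.log 2 ≤ 1 := by linarith [Real.log_two_lt_d9]
  have hlog2 : T / (N * m ^ 2) * Real.log m ≤ 3 * N := by
    push_cast at hlog
    nlinarith
  have hT0 : 0 ≤ T / (N * m ^ 2) :=
    div_nonneg (Finset.sum_nonneg fun u _ => hZ0 _ _ _) (by positivity)
  have h3 : T / (N * m ^ 2) * (12 / η ^ 2) ≤ 3 * N :=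
    (mul_le_mul_of_nonneg_left hm2 hT0).trans hlog2
  have h4 : T ≤ (η * (N * m) / 2) ^ 2 := by
    rw [div_mul_div_comm, div_le_iff₀ (by positivity)] at h3
    nlinarith
  refine le_trans (le_of_eq ?_) h4
  refine Finset.sum_congr rfl fun u _ => ?_
  refine Finset.sum_congr rfl fun w _ => ?_
  by_cases hu0 : u ∈ V0
  · simp only [hu0, if_true, k]
  · have := hk1 u w hu0
    simp only [k] at this
    simp only [k, this]
    simp

lemma asymp (ν δ η : ℝ) (hν : 0 < ν) (hδ : ν < δ) :
    ∃ q0 : ℕ, ∀ q : ℕ, q0 ≤ q →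
      ((⌊(q : ℝ) ^ (ν / 64)⌋₊ + 1 : ℕ) : ℝ) < (q : ℝ) ^ (ν / 32) ∧
      ((⌊(q : ℝ) ^ (ν / 64)⌋₊ + 1 : ℕ) : ℝ) * Real.log q ≤ ⌊(q : ℝ) ^ ν⌋₊ ∧
      1 ≤ ⌊(q : ℝ) ^ ν⌋₊ ∧ 1 ≤ ⌊(q : ℝ) ^ (δ - ν)⌋₊ ∧
      12 / η ^ 2 ≤ Real.log ⌊(q : ℝ) ^ (δ - ν)⌋₊ := by
  have hcast : Filter.Tendsto (fun q : ℕ => (q : ℝ)) Filter.atTop Filter.atTop :=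
    tendsto_natCast_atTop_atTop
  have pw : ∀ a : ℝ, 0 < a → Filter.Tendsto (fun q : ℕ => (q : ℝ) ^ a) Filter.atTop Filter.atTop :=
    fun a ha => (tendsto_rpow_atTop ha).comp hcast
  have f1 := (pw (ν / 64) (by linarith)).eventually_ge_atTop 3
  have f2 := (pw (δ - ν) (by linarith)).eventually_ge_atTop (Real.exp (12 / η ^ 2) + 1)
  have f3 : ∀ᶠ q : ℕ in Filter.atTop, Real.log q ≤ (q : ℝ) ^ (ν / 64) := by
    have := (isLittleO_log_rpow_atTop (r := ν / 64) (by linarith)).bound (c := 1) one_pos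
    filter_upwards [hcast.eventually this] with q hq
    have h2 : (0 : ℝ) ≤ (q : ℝ) ^ (ν / 64) := by positivity
    rw [one_mul, Real.norm_of_nonneg h2] at hq
    exact (Real.le_norm_self _).trans hq
  obtain ⟨q0, hq0⟩ := Filter.eventually_atTop.mp (f1.and (f2.and f3))
  refine ⟨q0, fun q hq => ?_⟩
  obtain ⟨g1, g2, g3⟩ := hq0 q hq
  set z := (q : ℝ) ^ (ν / 64) with hz
  have hq0' : (0 : ℝ) ≤ q := by positivity
  have z2 : (q : ℝ) ^ (ν / 32) = z ^ 2 := by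
    rw [hz, ← Real.rpow_mul_natCast hq0']; congr 1; push_cast; ring
  have z64 : (q : ℝ) ^ ν = z ^ 64 := by
    rw [hz, ← Real.rpow_mul_natCast hq0']; congr 1; push_cast; ring
  have hfl : (⌊z⌋₊ : ℝ) ≤ z := Nat.floor_le (by linarith)
  have hN : z ^ 64 - 1 < ⌊z ^ 64⌋₊ := Nat.sub_one_lt_floor _
  have z3 : z ^ 3 ≤ z ^ 64 := pow_le_pow_right₀ (by linarith) (by norm_num)
  have hm : (q : ℝ) ^ (δ - ν) - 1 < ⌊(q : ℝ) ^ (δ - ν)⌋₊ := Nat.sub_one_lt_floor _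
  have hexp := Real.exp_pos (12 / η ^ 2)
  rw [z2, z64]
  push_cast
  refine ⟨by nlinarith, ?_, ?_, ?_, ?_⟩
  · have : (⌊z⌋₊ + 1 : ℝ) * Real.log q ≤ (z + 1) * z := by
      have : 0 ≤ Real.log q := Real.log_natCast_nonneg q
      gcongr
    nlinarith
  · rw [Nat.one_le_floor_iff]; nlinarith
  · rw [Nat.one_le_floor_iff]; linarith
  · rw [Real.le_log_iff_exp_le (by linarith)]; linarith

/-- explicit expanders; Corollary 4.3.  For every ν ∈ (0,1/2),
δ ∈ (ν, 1−ν] and η ∈ (0,1) there exist τ ∈ (0, ν/32) and q₀ such that for every finite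
field F with q = |F| ≥ q₀ the following holds.  Set Δ = ⌊q^ν⌋·⌊q^{δ−ν}⌋ and let Γ be any
Δ-regular complete balanced bipartite multigraph with parts of size ⌊q^ν⌋ and edge set
E ⊆ F.  Then there are an integer t with q^τ < t < q^{ν/32} and a labeling L : V → F^t
such that the lifted graph Γ̄ satisfies λ₂(Γ̄) ≤ ηΔ. -/
theorem stmt12 (ν δ η : ℝ) (hν : ν ∈ Set.Ioo 0 (1/2 : ℝ))
    (hδ : δ ∈ Set.Ioc ν (1 - ν)) (hη : η ∈ Set.Ioo (0 : ℝ) 1) :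
    ∃ τ : ℝ, τ ∈ Set.Ioo 0 (ν / 32) ∧ ∃ q0 : ℕ,
      ∀ (F : Type) [Field F] [Fintype F] [DecidableEq F], q0 ≤ Fintype.card F →
      ∀ (V : Type) [Fintype V] [DecidableEq V] (V0 V1 : Finset V)
        (E : Finset F) (v0 v1 : ↥E → V),
        Disjoint V0 V1 → V0 ∪ V1 = Finset.univ →
        V0.card = Nat.floor ((Fintype.card F : ℝ) ^ ν) →
        V1.card = Nat.floor ((Fintype.card F : ℝ) ^ ν) →
        E.card = Nat.floor ((Fintype.card F : ℝ) ^ ν) *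
          (Nat.floor ((Fintype.card F : ℝ) ^ ν) * Nat.floor ((Fintype.card F : ℝ) ^ (δ - ν))) →
        (∀ e, v0 e ∈ V0) → (∀ e, v1 e ∈ V1) →
        (∀ u ∈ V0, ∀ w ∈ V1, Nat.card {e : ↥E // v0 e = u ∧ v1 e = w} =
          Nat.floor ((Fintype.card F : ℝ) ^ (δ - ν))) →
        ∃ t : ℕ, (Fintype.card F : ℝ) ^ τ < (t : ℕ) ∧
          (t : ℝ) < (Fintype.card F : ℝ) ^ (ν / 32) ∧
          ∃ L : V → Fin t → F,
            lambda2Lifted F t E v0 v1 L ≤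
              η * (Nat.floor ((Fintype.card F : ℝ) ^ ν) *
                Nat.floor ((Fintype.card F : ℝ) ^ (δ - ν)) : ℕ) := by
  obtain ⟨hν0, -⟩ := hν
  obtain ⟨hδ0, -⟩ := hδ
  obtain ⟨hη0, -⟩ := hη
  obtain ⟨q0, hq0⟩ := asymp ν δ η hν0 hδ0
  refine ⟨ν / 64, ⟨by linarith, by linarith⟩, q0, ?_⟩
  intro F _ _ _ hq V _ _ V0 V1 E v0 v1 hd hu hc0 hc1 _ h0 h1 hk
  obtain ⟨a1, a2, a3, a4, a5⟩ := hq0 _ hq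
  refine ⟨⌊(Fintype.card F : ℝ) ^ (ν / 64)⌋₊ + 1, ?_, a1, ?_⟩
  · push_cast
    exact Nat.lt_floor_add_one _
  obtain ⟨L, hL, hM⟩ := label_exists F _ V V0 V1 E v0 v1 hd hu _ _ a3 a4 hc0 hc1 h0 h1 hk
    η hη0 a5 a2
  refine ⟨L, ?_⟩
  have := lifted_bound F _ V V0 V1 E v0 v1 hd hu (Finset.card_pos.mp (by omega))
    (Finset.card_pos.mp (by omega)) h0 h1 _ hk L hL _ (by positivity) hM
  refine this.trans (le_of_eq ?_)
  push_cast
  ring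
end
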